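/- arXiv:2105.09181 — 2 statements merged into one kernel-verified Lean document; each statement's English description precedes it below -/
import Mathlib

section
/- Let d ≥ 1 and let A ⊂ ℤ^d be a finite nonempty set. Then there exists a polynomial P ∈ ℚ[X] of degree at most d such that for every integer N ≥ (2·|A|·w(A))^{(d+4)·|A|} one has |NA| = P(N). -/
open Pointwise MeasureTheory

noncomputable section

/-- Embedding of integer vectors into real vectors. -/
def emb (d : ℕ) : (Fin d → ℤ) → (Fin d → ℝ) := fun x i => (x i : ℝ)

/-- The `N`-fold sumset `NA` (with `0·A = {0}`). -/
def nfold (d : ℕ) (A : Set (Fin d → ℤ)) (N : ℕ) : Set (Fin d → ℤ) :=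
  {x | ∃ f : Fin N → (Fin d → ℤ), (∀ i, f i ∈ A) ∧ x = ∑ i, f i}

/-- `P(A) = ⋃_{N ≥ 1} NA`. -/
def PA (d : ℕ) (A : Set (Fin d → ℤ)) : Set (Fin d → ℤ) :=
  ⋃ N ∈ Set.Ici 1, nfold d A N

/-- The width `w(A) = max_{a₁,a₂ ∈ A} ‖a₁ - a₂‖_∞`. -/
def width (d : ℕ) (A : Finset (Fin d → ℤ)) : ℕ :=
  (A ×ˢ A).sup fun p => Finset.univ.sup fun i => (p.1 i - p.2 i).natAbs

/-- The convex hull `H(A)` in `ℝ^d`. -/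
def hull (d : ℕ) (A : Finset (Fin d → ℤ)) : Set (Fin d → ℝ) :=
  convexHull ℝ (emb d '' ↑A)

/-- The cone `C_B = {∑_{b ∈ B} c_b b : c_b ≥ 0}` generated by `B`. -/
def cone (d : ℕ) (B : Finset (Fin d → ℤ)) : Set (Fin d → ℝ) :=
  {x | ∃ c : (Fin d → ℤ) → ℝ, (∀ a, 0 ≤ c a) ∧ x = ∑ a ∈ B, c a • emb d a}

/-- The lattice (subgroup of `ℤ^d`) generated by a set `S`. -/
def latt (d : ℕ) (S : Set (Fin d → ℤ)) : AddSubgroup (Fin d → ℤ) :=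
  AddSubgroup.closure S

/-- The exceptional set `E(A) = (C_A ∩ Λ_A) ∖ P(A)`, viewed inside `ℤ^d`. -/
def excep (d : ℕ) (A : Finset (Fin d → ℤ)) : Set (Fin d → ℤ) :=
  {x | emb d x ∈ cone d A ∧ x ∈ latt d ↑A ∧ x ∉ PA d ↑A}

/-- The set of (lattice) extreme points of `H(A)`: those `p` with `emb p ∈ H(A)` such that
some `v ∈ span ℝ (A - A)`, `v ≠ 0`, satisfies `⟨v,x⟩ > ⟨v,p⟩` for all `x ∈ H(A) ∖ {p}`. -/
def exP (d : ℕ) (A : Finset (Fin d → ℤ)) : Set (Fin d → ℤ) :=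
  {p | emb d p ∈ hull d A ∧
    ∃ v ∈ Submodule.span ℝ (emb d '' ((A : Set (Fin d → ℤ)) - (A : Set (Fin d → ℤ)))),
      v ≠ (0 : Fin d → ℝ) ∧
      ∀ x ∈ hull d A, x ≠ emb d p → (∑ i, v i * emb d p i) < ∑ i, v i * x i}

/-- The structure equation
`NA = (N·H(A) ∩ (N·a₀ + Λ_{A-A})) ∖ ⋃_{a ∈ ex(H(A))} (N·a - E(a - A))`. -/
def structEq (d : ℕ) (A : Finset (Fin d → ℤ)) (a0 : Fin d → ℤ) (N : ℕ) : Prop :=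
  emb d '' nfold d ↑A N =
    ((N : ℝ) • hull d A ∩
      emb d '' (({N • a0} : Set (Fin d → ℤ)) +
        (latt d ((A : Set (Fin d → ℤ)) - (A : Set (Fin d → ℤ))) : Set (Fin d → ℤ)))) \
    ⋃ a ∈ exP d A,
      emb d '' (({N • a} : Set (Fin d → ℤ)) - excep d (A.image fun y => a - y))

/-- `H(A)` is a `d`-simplex: there is `B ⊆ A` with `|B| = d+1`, `B - B` spanning `ℝ^d`,
and `H(A) = H(B)`. -/
def IsSimplex (d : ℕ) (A : Finset (Fin d → ℤ)) : Prop :=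
  ∃ B ⊆ A, B.card = d + 1 ∧
    Submodule.span ℝ (emb d '' ((B : Set (Fin d → ℤ)) - (B : Set (Fin d → ℤ)))) = ⊤ ∧
    hull d B = hull d A

/-- `N_A(v)`: the minimal positive `N` with `v ∈ NA`, and `N_A(0) = 0`. -/
def NAfn (d : ℕ) (A : Set (Fin d → ℤ)) (v : Fin d → ℤ) : ℕ :=
  if v = 0 then 0 else sInf {N : ℕ | 0 < N ∧ v ∈ nfold d A N}

/-- The set `S(A,B)` of `B`-minimal elements. -/
def Smin (d : ℕ) (A B : Set (Fin d → ℤ)) : Set (Fin d → ℤ) :=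
  {0} ∪ {u | u ∈ PA d A ∧ u ≠ 0 ∧
    ∀ f : Fin (NAfn d A u) → (Fin d → ℤ), (∀ i, f i ∈ A) → u = ∑ i, f i →
      ∀ i, f i ∉ B ∪ ({0} : Set (Fin d → ℤ))}

open scoped Matrix.Norms.Elementwise in
/-- Siegel's lemma with a natural number bound, allowing an empty system. -/
lemma exists_int_vec_mulVec_eq_zero {α β : Type*} [Fintype α] [Fintype β] (M : Matrix α β ℤ)
    {w n : ℕ} (hw : 1 ≤ w) (hM : ∀ k i, |M k i| ≤ w)
    (hlt : Fintype.card α < Fintype.card β) (hn : Fintype.card β ≤ n) :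
    ∃ t : β → ℤ, t ≠ 0 ∧ M.mulVec t = 0 ∧ ∀ i, |t i| ≤ ((n * w) ^ n : ℕ) := by
  classical
  have hn1 : 1 ≤ n := by omega
  rcases Nat.eq_zero_or_pos (Fintype.card α) with h0 | hpos
  · have : IsEmpty α := Fintype.card_eq_zero_iff.1 h0
    have hβ : Nonempty β := Fintype.card_pos_iff.1 (by omega)
    refine ⟨1, one_ne_zero, Subsingleton.elim _ _, fun i => ?_⟩
    have : 1 ≤ (n * w) ^ n := Nat.one_le_pow _ _ (Nat.mul_pos hn1 hw)
    simp only [Pi.one_apply, abs_one]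
    exact_mod_cast this
  · obtain ⟨t, ht0, htM, htn⟩ := Int.Matrix.exists_ne_zero_int_vec_norm_le M hlt hpos
    refine ⟨t, ht0, htM, fun i => ?_⟩
    have hMn : ‖M‖ ≤ w := by
      rw [Matrix.norm_le_iff (by positivity)]
      intro k i
      rw [Int.norm_eq_abs]
      exact_mod_cast hM k i
    have hw' : (1 : ℝ) ≤ w := by exact_mod_cast hw
    have hn' : (Fintype.card β : ℝ) ≤ n := by exact_mod_cast hn
    have hn1' : (1 : ℝ) ≤ n := by exact_mod_cast hn1
    have hlt' : (Fintype.card α : ℝ) + 1 ≤ Fintype.card β := by exact_mod_cast hlt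
    have hbase : (Fintype.card β : ℝ) * max 1 ‖M‖ ≤ n * w :=
      mul_le_mul hn' (max_le hw' hMn) (by positivity) (by positivity)
    have hexp : (Fintype.card α : ℝ) / (Fintype.card β - Fintype.card α) ≤ n := by
      rw [div_le_iff₀ (by linarith)]
      nlinarith [(Nat.cast_nonneg (Fintype.card α) : (0 : ℝ) ≤ Fintype.card α)]
    have key : ‖t‖ ≤ ((n : ℝ) * w) ^ n := by
      refine htn.trans ((Real.rpow_le_rpow (by positivity) hbase
        (div_nonneg (by positivity) (by linarith))).trans ?_)
      rw [← Real.rpow_natCast]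
      exact Real.rpow_le_rpow_of_exponent_le (by nlinarith) hexp
    have h2 := (norm_le_pi_norm t i).trans key
    rw [Int.norm_eq_abs] at h2
    exact_mod_cast h2

/-- A rational kernel vector yields a bounded integral kernel vector with smaller support. -/
lemma exists_bounded_kernel_vec {κ ι : Type*} [Fintype κ] [Fintype ι] (M : Matrix κ ι ℤ) {w : ℕ}
    (hw : 1 ≤ w) (hM : ∀ k i, |M k i| ≤ w) (z : ι → ℚ) (hz : z ≠ 0)
    (hMz : ∀ k, ∑ i, (M k i : ℚ) * z i = 0) :
    ∃ t : ι → ℤ, t ≠ 0 ∧ M.mulVec t = 0 ∧ (∀ i, z i = 0 → t i = 0) ∧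
      ∀ i, |t i| ≤ ((Fintype.card ι * w) ^ Fintype.card ι : ℕ) := by
  classical
  let S := {i // z i ≠ 0}
  let R : κ → S → ℚ := fun k i => M k i
  let V := Submodule.span ℚ (Set.range R)
  let φ : (S → ℚ) →ₗ[ℚ] ℚ := ∑ i : S, z i • LinearMap.proj i
  have hφ : ∀ v, φ v = ∑ i : S, z i * v i := fun v => by simp [φ]
  have sum_S : ∀ f : ι → ℚ, (∀ i, z i = 0 → f i = 0) → ∑ i : S, f i = ∑ i, f i := by
    intro f hf
    rw [← Finset.sum_subtype (Finset.univ.filter fun i => z i ≠ 0) (by simp) f]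
    apply Finset.sum_subset (Finset.subset_univ _)
    intro i _ hi
    exact hf i (by simpa using hi)
  have hV : V ≤ LinearMap.ker φ := by
    rw [Submodule.span_le]
    rintro _ ⟨k, rfl⟩
    simp only [SetLike.mem_coe, LinearMap.mem_ker, hφ, R]
    rw [sum_S (fun i => z i * (M k i : ℚ)) (fun i hi => by simp [hi]), ← hMz k]
    exact Finset.sum_congr rfl fun i _ => mul_comm _ _
  have hVtop : V ≠ ⊤ := by
    intro h
    obtain ⟨i, hi⟩ := Function.ne_iff.1 hz
    have h1 : (Pi.single ⟨i, hi⟩ 1 : S → ℚ) ∈ LinearMap.ker φ := hV (h ▸ Submodule.mem_top)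
    rw [LinearMap.mem_ker, hφ] at h1
    rw [Finset.sum_eq_single ⟨i, hi⟩ (fun j _ hj => by simp [hj]) (by simp)] at h1
    exact hi (by simpa using h1)
  have hrank : Module.finrank ℚ V < Fintype.card S := by
    simpa using Submodule.finrank_lt hVtop
  obtain ⟨f, hf, hspan, -⟩ := Submodule.exists_fun_fin_finrank_span_eq ℚ (Set.range R)
  choose k hk using hf
  obtain ⟨t, ht0, htM, htn⟩ := exists_int_vec_mulVec_eq_zero
    (Matrix.of fun (j : Fin (Module.finrank ℚ V)) (i : S) => M (k j) i) hw
    (fun j i => hM _ _) (by simpa using hrank) (Fintype.card_subtype_le _)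
  let ψ : (S → ℚ) →ₗ[ℚ] ℚ := ∑ i : S, (t i : ℚ) • LinearMap.proj i
  have hψ : ∀ v, ψ v = ∑ i : S, (t i : ℚ) * v i := fun v => by simp [ψ]
  have hVψ : V ≤ LinearMap.ker ψ := by
    change Submodule.span ℚ (Set.range R) ≤ _
    rw [← hspan, Submodule.span_le]
    rintro _ ⟨j, rfl⟩
    have h1 := congrFun htM j
    simp only [Matrix.mulVec, dotProduct, Matrix.of_apply, Pi.zero_apply] at h1
    simp only [SetLike.mem_coe, LinearMap.mem_ker, hψ, ← hk, R]
    have h2 : ((∑ i : S, M (k j) i * t i : ℤ) : ℚ) = 0 := by rw [h1]; simp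
    push_cast at h2
    exact (Finset.sum_congr rfl fun i _ => mul_comm _ _).trans h2
  let t' : ι → ℤ := fun i => if h : z i ≠ 0 then t ⟨i, h⟩ else 0
  have ht' : ∀ i : S, t' i = t i := fun i => by
    simp only [t']; rw [dif_pos i.2]
  have ht'0 : ∀ i, z i = 0 → t' i = 0 := fun i hi => by simp [t', hi]
  refine ⟨t', fun h => ht0 (funext fun i => ?_), funext fun k' => ?_, ht'0, fun i => ?_⟩
  · rw [← ht', h]; rfl
  · have h1 : ψ (R k') = 0 := hVψ (Submodule.subset_span ⟨k', rfl⟩)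
    rw [hψ] at h1
    simp only [← ht', R] at h1
    rw [sum_S (fun i => (t' i : ℚ) * (M k' i : ℚ)) (fun i hi => by simp [ht'0 i hi])] at h1
    simp only [Matrix.mulVec, dotProduct, Pi.zero_apply]
    have h2 : ∑ i, t' i * M k' i = 0 := by exact_mod_cast h1
    rw [← h2]
    exact Finset.sum_congr rfl fun i _ => mul_comm _ _
  · by_cases h : z i = 0
    · rw [ht'0 i h, abs_zero]; positivity
    · have := htn ⟨i, h⟩
      rwa [← ht'] at this

/-- Moving from a nonnegative vector against `t` until a coordinate vanishes. -/
lemma exists_sub_smul_nonneg {ι : Type*} [Fintype ι] (z t : ι → ℚ) (hz : ∀ i, 0 ≤ z i)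
    (ht : ∀ i, z i = 0 → t i = 0) (hpos : ∃ i, 0 < t i) :
    ∃ c : ℚ, 0 < c ∧ (∀ i, 0 ≤ z i - c * t i) ∧ ∃ i, z i ≠ 0 ∧ z i - c * t i = 0 := by
  classical
  obtain ⟨i₀, hi₀, hmin⟩ := Finset.exists_min_image (Finset.univ.filter fun i => 0 < t i)
    (fun i => z i / t i) (by simpa [Finset.Nonempty] using hpos)
  simp only [Finset.mem_filter, Finset.mem_univ, true_and] at hi₀ hmin
  have hz0 : z i₀ ≠ 0 := fun h => hi₀.ne' (ht _ h)
  have hz1 : 0 < z i₀ := lt_of_le_of_ne (hz _) hz0.symm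
  have hc : 0 < z i₀ / t i₀ := div_pos hz1 hi₀
  refine ⟨z i₀ / t i₀, hc, fun i => ?_, i₀, hz0, ?_⟩
  · rcases lt_or_ge 0 (t i) with h | h
    · have := hmin i h
      rw [le_div_iff₀ h] at this
      linarith
    · have := hz i
      nlinarith
  · rw [div_mul_cancel₀ _ hi₀.ne', sub_self]

lemma support_card_lt {ι : Type*} [Fintype ι] (z z' : ι → ℚ) (h : ∀ i, z i = 0 → z' i = 0)
    (h' : ∃ i, z i ≠ 0 ∧ z' i = 0) :
    (Finset.univ.filter fun i => z' i ≠ 0).card < (Finset.univ.filter fun i => z i ≠ 0).card := by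
  classical
  apply Finset.card_lt_card
  obtain ⟨i, hi, hi'⟩ := h'
  refine (Finset.ssubset_iff_of_subset fun j hj => ?_).2 ⟨i, by simpa using hi, by simpa using hi'⟩
  simp only [Finset.mem_filter, Finset.mem_univ, true_and] at hj ⊢
  exact fun h0 => hj (h j h0)

/-- A nonzero nonnegative kernel vector dominates the support of a bounded nonnegative integral
kernel vector. -/
lemma exists_nonneg_kernel_vec {κ ι : Type*} [Fintype κ] [Fintype ι] (M : Matrix κ ι ℤ) {w : ℕ}
    (hw : 1 ≤ w) (hM : ∀ k i, |M k i| ≤ w) (z : ι → ℚ) (hz : z ≠ 0) (hz0 : ∀ i, 0 ≤ z i)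
    (hMz : ∀ k, ∑ i, (M k i : ℚ) * z i = 0) :
    ∃ g : ι → ℤ, g ≠ 0 ∧ M.mulVec g = 0 ∧ (∀ i, z i = 0 → g i = 0) ∧ (∀ i, 0 ≤ g i) ∧
      ∀ i, g i ≤ ((Fintype.card ι * w) ^ Fintype.card ι : ℕ) := by
  classical
  induction hs : (Finset.univ.filter fun i => z i ≠ 0).card using Nat.strong_induction_on
    generalizing z with
  | _ s ih =>
  obtain ⟨t, ht0, htM, htz, htn⟩ := exists_bounded_kernel_vec M hw hM z hz hMz
  by_cases hp : ∀ i, t i ≤ 0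
  · refine ⟨-t, neg_ne_zero.2 ht0, by rw [Matrix.mulVec_neg, htM, neg_zero], ?_, ?_, ?_⟩
    · intro i hi; simp [htz i hi]
    · intro i; simpa using hp i
    · intro i; exact (neg_le_abs (t i)).trans (htn i)
  by_cases hq : ∀ i, 0 ≤ t i
  · exact ⟨t, ht0, htM, htz, hq, fun i => (le_abs_self _).trans (htn i)⟩
  push Not at hp hq
  obtain ⟨c, hc, hnn, hex⟩ := exists_sub_smul_nonneg z (fun i => (t i : ℚ)) hz0
    (fun i hi => by simp [htz i hi]) (by simpa using hp)
  have hsupp : ∀ i, z i = 0 → z i - c * t i = 0 := fun i hi => by simp [hi, htz i hi]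
  obtain ⟨j, hj⟩ := hq
  obtain ⟨g, hg0, hgM, hgz, hgn, hgb⟩ := ih _
    (by rw [← hs]; exact support_card_lt z (fun i => z i - c * t i) hsupp hex)
    (fun i => z i - c * t i) (fun h => by
      have h1 := congrFun h j
      simp only [Pi.zero_apply] at h1
      have h2 := hz0 j
      have h3 : (t j : ℚ) < 0 := by exact_mod_cast hj
      nlinarith) hnn (fun k => by
      have h1 : ∑ i, M k i * t i = 0 := congrFun htM k
      have h2 : ∑ i, (M k i : ℚ) * t i = 0 := by exact_mod_cast h1
      simp only [mul_sub, Finset.sum_sub_distrib, hMz k, zero_sub, neg_eq_zero]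
      rw [← mul_zero c, ← h2, Finset.mul_sum]
      exact Finset.sum_congr rfl fun i _ => by ring) rfl
  exact ⟨g, hg0, hgM, fun i hi => hgz i (hsupp i hi), hgn, hgb⟩

/-- A nonnegative kernel vector not dominating any bounded integral kernel vector is bounded. -/
lemma kernel_vec_le {κ ι : Type*} [Fintype κ] [Fintype ι] (M : Matrix κ ι ℤ) {w : ℕ}
    (hw : 1 ≤ w) (hM : ∀ k i, |M k i| ≤ w) (z : ι → ℚ) (hz0 : ∀ i, 0 ≤ z i)
    (hMz : ∀ k, ∑ i, (M k i : ℚ) * z i = 0)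
    (hmin : ∀ g : ι → ℤ, g ≠ 0 → M.mulVec g = 0 → (∀ i, 0 ≤ g i) →
      (∀ i, g i ≤ ((Fintype.card ι * w) ^ Fintype.card ι : ℕ)) → ¬ ∀ i, (g i : ℚ) ≤ z i) (i : ι) :
    z i ≤ (Finset.univ.filter fun i => z i ≠ 0).card *
      ((Fintype.card ι * w) ^ Fintype.card ι : ℕ) := by
  classical
  induction hs : (Finset.univ.filter fun i => z i ≠ 0).card using Nat.strong_induction_on
    generalizing z with
  | _ s ih =>
  by_cases hz : z = 0
  · rw [hz, Pi.zero_apply]; positivity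
  obtain ⟨g, hg0, hgM, hgz, hgn, hgb⟩ := exists_nonneg_kernel_vec M hw hM z hz hz0 hMz
  obtain ⟨c, hc, hnn, hex⟩ := exists_sub_smul_nonneg z (fun i => (g i : ℚ)) hz0
    (fun i hi => by simp [hgz i hi]) (by
      obtain ⟨j, hj⟩ := Function.ne_iff.1 hg0
      exact ⟨j, by exact_mod_cast lt_of_le_of_ne (hgn j) (Ne.symm hj)⟩)
  have hgn' : ∀ i, (0 : ℚ) ≤ g i := fun i => by exact_mod_cast hgn i
  have hc1 : c < 1 := by
    by_contra h
    push Not at h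
    refine hmin g hg0 hgM hgn hgb fun i => ?_
    have := hnn i
    have := hgn' i
    nlinarith
  have hsupp : ∀ i, z i = 0 → z i - c * g i = 0 := fun i hi => by simp [hi, hgz i hi]
  have hlt := support_card_lt z (fun i => z i - c * g i) hsupp hex
  have h1 := ih _ (by rw [← hs]; exact hlt)
    (fun i => z i - c * g i) hnn (fun k => by
      have h1 : ∑ i, M k i * g i = 0 := congrFun hgM k
      have h2 : ∑ i, (M k i : ℚ) * g i = 0 := by exact_mod_cast h1
      simp only [mul_sub, Finset.sum_sub_distrib, hMz k, zero_sub, neg_eq_zero]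
      rw [← mul_zero c, ← h2, Finset.mul_sum]
      exact Finset.sum_congr rfl fun i _ => by ring)
    (fun g' a b c' d h => hmin g' a b c' d fun i => (h i).trans (by
      have := hgn' i
      simp only [tsub_le_iff_right]
      nlinarith)) rfl
  rw [hs] at hlt
  have h2 : ((Finset.univ.filter fun i => z i - c * g i ≠ 0).card : ℚ) + 1 ≤ s := by
    exact_mod_cast hlt
  have h3 : (g i : ℚ) ≤ ((Fintype.card ι * w) ^ Fintype.card ι : ℕ) := by exact_mod_cast hgb i
  have h4 : (0 : ℚ) ≤ ((Fintype.card ι * w) ^ Fintype.card ι : ℕ) := by positivity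
  generalize (((Fintype.card ι * w) ^ Fintype.card ι : ℕ) : ℚ) = C at *
  have h5 := hgn' i
  nlinarith

/-- A kernel vector with a large coordinate has a bounded sign-compatible integral part. -/
lemma exists_conformal_kernel_vec {κ ι : Type*} [Fintype κ] [Fintype ι] (M : Matrix κ ι ℤ)
    {w : ℕ} (hw : 1 ≤ w) (hM : ∀ k i, |M k i| ≤ w) (z : ι → ℤ) (hMz : M.mulVec z = 0) (i₀ : ι)
    (hi₀ : ((Fintype.card ι * (Fintype.card ι * w) ^ Fintype.card ι : ℕ) : ℤ) < |z i₀|) :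
    ∃ g : ι → ℤ, g ≠ 0 ∧ M.mulVec g = 0 ∧
      (∀ i, |g i| ≤ ((Fintype.card ι * w) ^ Fintype.card ι : ℕ)) ∧
      ∀ i, (0 ≤ z i → 0 ≤ g i ∧ g i ≤ z i) ∧ (z i ≤ 0 → z i ≤ g i ∧ g i ≤ 0) := by
  classical
  let σ : ι → ℤ := fun i => if 0 ≤ z i then 1 else -1
  have hσ : ∀ i, (0 ≤ z i ∧ σ i = 1) ∨ (z i < 0 ∧ σ i = -1) := by
    intro i
    by_cases h : 0 ≤ z i
    · exact Or.inl ⟨h, by simp [σ, h]⟩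
    · exact Or.inr ⟨by omega, by simp [σ, h]⟩
  have hσa : ∀ i, σ i * z i = |z i| := by
    intro i
    rcases hσ i with ⟨h, e⟩ | ⟨h, e⟩
    · rw [e, one_mul, abs_of_nonneg h]
    · rw [e, neg_one_mul, abs_of_neg h]
  have hσσ : ∀ i, σ i * σ i = 1 := by
    intro i
    rcases hσ i with ⟨h, e⟩ | ⟨h, e⟩ <;> simp [e]
  let M' : Matrix κ ι ℤ := Matrix.of fun k i => M k i * σ i
  have hM' : ∀ k i, |M' k i| ≤ w := by
    intro k i
    have : |σ i| = 1 := by rcases hσ i with ⟨h, e⟩ | ⟨h, e⟩ <;> simp [e]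
    simp only [M', Matrix.of_apply, abs_mul, this, mul_one]
    exact hM k i
  by_contra hcon
  have hle := kernel_vec_le M' hw hM' (fun i => ((|z i| : ℤ) : ℚ)) (fun i => by positivity)
    (fun k => by
      have h1 : ∑ i, M k i * z i = 0 := congrFun hMz k
      have h2 : ∑ i, M' k i * |z i| = 0 := by
        rw [← h1]
        refine Finset.sum_congr rfl fun i _ => ?_
        rw [← hσa]
        simp only [M', Matrix.of_apply]
        linear_combination (M k i * z i) * hσσ i
      exact_mod_cast h2)
    (fun g hg0 hgM hgn hgb hgz => hcon (by
      have hgz' : ∀ i, g i ≤ |z i| := fun i => by exact_mod_cast hgz i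
      refine ⟨fun i => σ i * g i, fun h => hg0 (funext fun i => ?_), funext fun k => ?_,
        fun i => ?_, fun i => ?_⟩
      · have h1 := congrFun h i
        simp only [Pi.zero_apply] at h1 ⊢
        linear_combination σ i * h1 - g i * hσσ i
      · have h1 : ∑ i, M k i * σ i * g i = 0 := congrFun hgM k
        simp only [Matrix.mulVec, dotProduct, Pi.zero_apply]
        rw [← h1]
        exact Finset.sum_congr rfl fun i _ => by ring
      · have : |σ i| = 1 := by rcases hσ i with ⟨h, e⟩ | ⟨h, e⟩ <;> simp [e]
        rw [abs_mul, this, one_mul, abs_of_nonneg (hgn i)]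
        exact hgb i
      · have h1 := hgn i
        have h2 := hgz' i
        rcases hσ i with ⟨h, e⟩ | ⟨h, e⟩
        · rw [abs_of_nonneg h] at h2
          simp only [e]
          constructor <;> intro <;> constructor <;> omega
        · rw [abs_of_neg h] at h2
          simp only [e]
          constructor <;> intro <;> constructor <;> omega)) i₀
  have hcard : (Finset.univ.filter fun i => ((|z i| : ℤ) : ℚ) ≠ 0).card ≤ Fintype.card ι :=
    Finset.card_le_univ _
  have h1 : |z i₀| ≤ ((Finset.univ.filter fun i => ((|z i| : ℤ) : ℚ) ≠ 0).card : ℤ) *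
      ((Fintype.card ι * w) ^ Fintype.card ι : ℕ) := by exact_mod_cast hle
  have h2 := h1.trans (mul_le_mul_of_nonneg_right (Int.ofNat_le.2 hcard) (by positivity))
  rw [Nat.cast_mul] at hi₀
  exact absurd (lt_of_lt_of_le hi₀ h2) (lt_irrefl _)

/-- The number of vectors of weight `N` with a prescribed truncation at `K` is polynomial in `N`. -/
lemma exists_poly_card_trunc_eq {ι : Type*} [Fintype ι] [DecidableEq ι] (K : ℕ) (v : ι → ℕ)
    (hv : ∀ i, v i ≤ K) :
    ∃ P : Polynomial ℚ, ∀ N : ℕ, Fintype.card ι * K < N →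
      ((((Finset.univ : Finset ι).piAntidiag N).filter fun x => (fun i => min (x i) K) = v).card
        : ℚ) = P.eval (N : ℚ) := by
  classical
  have hvs : ∑ i, v i ≤ Fintype.card ι * K := by
    simpa using Finset.sum_le_sum fun (i : ι) (_ : i ∈ Finset.univ) => hv i
  set T := Finset.univ.filter fun i => v i = K with hT
  rcases T.eq_empty_or_nonempty with hT0 | hT1
  · refine ⟨0, fun N hN => ?_⟩
    rw [Polynomial.eval_zero, Nat.cast_eq_zero, Finset.card_eq_zero, Finset.filter_eq_empty_iff]
    intro x hx hxv
    rw [Finset.mem_piAntidiag] at hx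
    have : x = v := by
      funext i
      have h1 : min (x i) K = v i := congrFun hxv i
      have h2 : v i ≠ K := fun h => by
        have : i ∈ T := by simp [hT, h]
        simp [hT0] at this
      have := hv i
      omega
    rw [this] at hx
    exact absurd hx.1 (hvs.trans_lt hN).ne
  · refine ⟨Polynomial.preHilbertPoly ℚ (T.card - 1) (∑ i, v i), fun N hN => ?_⟩
    rw [Polynomial.preHilbertPoly_eq_choose_sub_add ℚ _ (hvs.trans hN.le)]
    have hT2 : 1 ≤ T.card := hT1.card_pos
    have hcard : (T.finsuppAntidiag (N - ∑ i, v i)).card =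
        (N - ∑ i, v i + (T.card - 1)).choose (T.card - 1) := by
      rw [Finset.card_finsuppAntidiag_nat_eq_choose, Nat.choose_symm_of_eq_add (b := T.card - 1)]
      · congr 1; omega
      · omega
    rw [← hcard, Nat.cast_inj, eq_comm]
    have hsupp : ∀ y : ι →₀ ℕ, y.support ⊆ T → ∀ i, v i ≠ K → y i = 0 := by
      intro y hy i hi
      by_contra h
      exact hi (by simpa [hT] using hy (Finsupp.mem_support_iff.2 h))
    refine Finset.card_bij (fun y _ i => y i + v i) ?_ ?_ ?_
    · intro y hy
      rw [Finset.mem_finsuppAntidiag] at hy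
      rw [Finset.mem_filter, Finset.mem_piAntidiag]
      refine ⟨⟨?_, fun i _ => Finset.mem_univ i⟩, ?_⟩
      · have h1 : ∑ i, y i = N - ∑ i, v i := by
          rw [← hy.1]
          exact (Finset.sum_subset (Finset.subset_univ _) fun i _ hi =>
            hsupp y hy.2 i (by simpa [hT] using hi)).symm
        rw [Finset.sum_add_distrib, h1]
        exact Nat.sub_add_cancel (hvs.trans hN.le)
      · funext i
        have h1 := hv i
        change min (y i + v i) K = v i
        by_cases h : v i = K
        · omega
        · have := hsupp y hy.2 i h
          omega
    · intro y _ y' _ h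
      ext i
      exact Nat.add_right_cancel (congrFun h i)
    · intro x hx
      rw [Finset.mem_filter, Finset.mem_piAntidiag] at hx
      obtain ⟨⟨hxN, -⟩, hxv⟩ := hx
      have hle : ∀ i, v i ≤ x i := fun i => by rw [← hxv]; exact min_le_left _ _
      have hx0 : ∀ i, i ∉ T → x i - v i = 0 := by
        intro i hi
        have h1 : v i ≠ K := by simpa [hT] using hi
        have h2 : min (x i) K = v i := congrFun hxv i
        have := hv i
        omega
      refine ⟨Finsupp.equivFunOnFinite.symm fun i => x i - v i, ?_, ?_⟩
      · rw [Finset.mem_finsuppAntidiag]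
        constructor
        · simp only [Finsupp.equivFunOnFinite_symm_apply_apply]
          rw [Finset.sum_subset (Finset.subset_univ T) fun i _ hi => hx0 i hi,
            Finset.sum_tsub_distrib _ fun i _ => hle i, hxN]
        · intro i hi
          by_contra h
          simp [hx0 i h] at hi
      · funext i
        simp only [Finsupp.equivFunOnFinite_symm_apply_apply]
        have := hle i
        omega

/-- If membership in `L` only depends on the truncation at `K`, then the number of elements of `L`
of weight `N` is polynomial in `N`. -/
lemma exists_poly_card_filter_piAntidiag {ι : Type*} [Fintype ι] [DecidableEq ι] (K : ℕ)
    (L : (ι → ℕ) → Prop) [DecidablePred L] (hL : ∀ x, L x ↔ L fun i => min (x i) K) :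
    ∃ P : Polynomial ℚ, ∀ N : ℕ, Fintype.card ι * K < N →
      ((((Finset.univ : Finset ι).piAntidiag N).filter L).card : ℚ) = P.eval (N : ℚ) := by
  classical
  let B := (Fintype.piFinset fun _ : ι => Finset.range (K + 1)).filter L
  have hB : ∀ v ∈ B, (∀ i, v i ≤ K) ∧ L v := by
    intro v hv
    simp only [B, Finset.mem_filter, Fintype.mem_piFinset, Finset.mem_range] at hv
    exact ⟨fun i => Nat.lt_succ_iff.1 (hv.1 i), hv.2⟩
  choose! P hP using fun (v : ι → ℕ) (hv : ∀ i, v i ≤ K) => exists_poly_card_trunc_eq K v hv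
  refine ⟨∑ v ∈ B, P v, fun N hN => ?_⟩
  rw [Finset.card_eq_sum_card_fiberwise (f := fun x i => min (x i) K) (t := B),
    Polynomial.eval_finsetSum, Nat.cast_sum]
  · refine Finset.sum_congr rfl fun v hv => ?_
    rw [← hP v (hB v hv).1 N hN, Finset.filter_filter]
    congr 2
    refine Finset.filter_congr fun x _ => ?_
    refine ⟨fun h => h.2, fun h => ⟨?_, h⟩⟩
    rw [hL, h]
    exact (hB v hv).2
  · intro x hx
    rw [Finset.mem_coe, Finset.mem_filter] at hx
    simp only [B, Finset.coe_filter, Set.mem_ofPred_eq, Fintype.mem_piFinset, Finset.mem_range]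
    exact ⟨fun i => by omega, (hL x).1 hx.2⟩

/-- A rational polynomial bounded by `(m x + 1) ^ d` at large naturals has degree at most `d`. -/
lemma natDegree_le_of_eval_le (P : Polynomial ℚ) (d m N₀ : ℕ)
    (h : ∀ N : ℕ, N₀ ≤ N → |P.eval (N : ℚ)| ≤ (m * N + 1 : ℚ) ^ d) : P.natDegree ≤ d := by
  by_contra! hd
  let Q : Polynomial ℚ := (Polynomial.C (m : ℚ) * Polynomial.X + 1) ^ d
  have hQe : ∀ x : ℚ, Q.eval x = (m * x + 1) ^ d := fun x => by simp [Q]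
  have hQ0 : Q ≠ 0 := fun h0 => by
    have := hQe 0
    simp [h0] at this
  have hP0 : P ≠ 0 := fun h0 => by simp [h0] at hd
  have hQd : Q.natDegree ≤ d := by
    refine Polynomial.natDegree_pow_le.trans ?_
    have : (Polynomial.C (m : ℚ) * Polynomial.X + 1).natDegree ≤ 1 := by compute_degree
    nlinarith
  have hdeg : Q.degree < P.degree := by
    rw [Polynomial.degree_eq_natDegree hQ0, Polynomial.degree_eq_natDegree hP0]
    exact_mod_cast hQd.trans_lt hd
  have ht := (Polynomial.abs_div_tendsto_atTop_atTop_of_degree_gt P Q hdeg hQ0).comp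
    (tendsto_natCast_atTop_atTop (R := ℚ))
  obtain ⟨N, hN1, hN2⟩ := ((ht.eventually_gt_atTop 1).and
    (Filter.eventually_ge_atTop N₀)).exists
  have h1 := h N hN2
  have h2 : (0 : ℚ) < (m * N + 1 : ℚ) ^ d := by positivity
  simp only [Function.comp, abs_div, hQe, abs_of_pos h2] at hN1
  rw [lt_div_iff₀ h2] at hN1
  linarith

/-- `x` is reducible if some natural vector in its fibre under `M` is lexicographically smaller. -/
def Reducible {κ ι : Type*} [Fintype ι] [LinearOrder ι] (M : Matrix κ ι ℤ) (x : ι → ℕ) : Prop :=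
  ∃ y : ι → ℕ, M.mulVec (fun i => (x i : ℤ) - y i) = 0 ∧ 0 < toLex fun i => (x i : ℤ) - y i

lemma Reducible.mono {κ ι : Type*} [Fintype ι] [LinearOrder ι] {M : Matrix κ ι ℤ} {x x' : ι → ℕ}
    (hx : Reducible M x) (h : ∀ i, x i ≤ x' i) : Reducible M x' := by
  obtain ⟨y, hy⟩ := hx
  refine ⟨fun i => y i + (x' i - x i), ?_⟩
  have : (fun i => (x' i : ℤ) - (y i + (x' i - x i) : ℕ)) = fun i => (x i : ℤ) - y i := by
    funext i
    have := h i
    omega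
  rwa [this]

lemma reducible_toNat {κ ι : Type*} [Fintype ι] [LinearOrder ι] {M : Matrix κ ι ℤ} {g : ι → ℤ}
    (hg : M.mulVec g = 0) (hpos : 0 < toLex g) : Reducible M fun i => (g i).toNat := by
  refine ⟨fun i => (-g i).toNat, ?_⟩
  have : (fun i => ((g i).toNat : ℤ) - ((-g i).toNat : ℤ)) = g := by
    funext i
    omega
  rw [this]
  exact ⟨hg, hpos⟩

/-- A reducible vector with a large coordinate is not minimal among reducible vectors. -/
lemma Reducible.exists_lt {κ ι : Type*} [Fintype κ] [Fintype ι] [LinearOrder ι]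
    {M : Matrix κ ι ℤ} {w : ℕ} (hw : 1 ≤ w) (hM : ∀ k i, |M k i| ≤ w)
    (hM1 : ∀ g, M.mulVec g = 0 → (∀ i, g i ≤ 0) → g = 0) {x : ι → ℕ} (hx : Reducible M x) (i₀ : ι)
    (hi₀ : Fintype.card ι * (Fintype.card ι * w) ^ Fintype.card ι < x i₀) :
    ∃ x', Reducible M x' ∧ (∀ i, x' i ≤ x i) ∧ ∃ i, x' i < x i := by
  obtain ⟨y, hyM, hyp⟩ := hx
  by_cases hxy : ∃ j, 0 < x j ∧ 0 < y j
  · obtain ⟨j, hxj, hyj⟩ := hxy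
    refine ⟨fun i => if i = j then x i - 1 else x i, ⟨fun i => if i = j then y i - 1 else y i, ?_⟩,
      fun i => ?_, j, ?_⟩
    · have : (fun i => ((if i = j then x i - 1 else x i : ℕ) : ℤ) -
          ((if i = j then y i - 1 else y i : ℕ) : ℤ)) = fun i => (x i : ℤ) - y i := by
        funext i
        split_ifs with h
        · subst h; omega
        · rfl
      rw [this]
      exact ⟨hyM, hyp⟩
    · simp only
      split_ifs <;> omega
    · simp only [if_true]; omega
  push Not at hxy
  set z : ι → ℤ := fun i => (x i : ℤ) - y i with hz
  have hz1 : ∀ i, (0 ≤ z i ∧ z i = x i) ∨ (z i ≤ 0 ∧ x i = 0) := by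
    intro i
    have := hxy i
    simp only [hz]
    omega
  have hcard : 1 ≤ Fintype.card ι := Fintype.card_pos_iff.2 ⟨i₀⟩
  have hC : (Fintype.card ι * w) ^ Fintype.card ι ≤
      Fintype.card ι * (Fintype.card ι * w) ^ Fintype.card ι := Nat.le_mul_of_pos_left _ hcard
  have hzi : z i₀ = x i₀ := by
    rcases hz1 i₀ with h | h
    · exact h.2
    · omega
  obtain ⟨g, hg0, hgM, hgb, hgz⟩ := exists_conformal_kernel_vec M hw hM z hyM i₀ (by
    rw [hzi, abs_of_nonneg (by positivity)]
    exact_mod_cast hi₀)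
  rcases lt_trichotomy 0 (toLex g) with h | h | h
  · refine ⟨_, reducible_toNat hgM h, fun i => ?_, i₀, ?_⟩
    · have := hgz i
      have := hz1 i
      omega
    · have h1 := (le_abs_self _).trans (hgb i₀)
      generalize (Fintype.card ι * w) ^ Fintype.card ι = C at *
      generalize Fintype.card ι * C = D at *
      omega
  · exact absurd (toLex_eq_zero.1 h.symm) hg0
  · obtain ⟨j, hj⟩ : ∃ j, 0 < g j := by
      by_contra! hcon
      exact hg0 (hM1 g hgM hcon)
    refine ⟨_, reducible_toNat (g := z - g) (by rw [Matrix.mulVec_sub, hyM, hgM, sub_zero]) ?_,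
      fun i => ?_, j, ?_⟩
    · rw [toLex_sub]
      exact sub_pos.2 (h.trans hyp)
    · have := hgz i
      have := hz1 i
      simp only [Pi.sub_apply]
      omega
    · have := hgz j
      have := hz1 j
      simp only [Pi.sub_apply]
      omega

/-- Reducibility only depends on a truncation of the coordinates. -/
lemma reducible_iff_trunc {κ ι : Type*} [Fintype κ] [Fintype ι] [LinearOrder ι]
    {M : Matrix κ ι ℤ} {w : ℕ} (hw : 1 ≤ w) (hM : ∀ k i, |M k i| ≤ w)
    (hM1 : ∀ g, M.mulVec g = 0 → (∀ i, g i ≤ 0) → g = 0) (x : ι → ℕ) :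
    Reducible M x ↔ Reducible M
      fun i => min (x i) (Fintype.card ι * (Fintype.card ι * w) ^ Fintype.card ι) := by
  refine ⟨fun hx => ?_, fun h => h.mono fun i => min_le_left _ _⟩
  induction hs : ∑ i, x i using Nat.strong_induction_on generalizing x with
  | _ s ih =>
  by_cases hb : ∃ i₀, Fintype.card ι * (Fintype.card ι * w) ^ Fintype.card ι < x i₀
  · obtain ⟨i₀, hi₀⟩ := hb
    obtain ⟨x', hx', hle, j, hj⟩ := hx.exists_lt hw hM hM1 i₀ hi₀
    refine (ih _ ?_ x' hx' rfl).mono fun i => min_le_min_right _ (hle i)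
    rw [← hs]
    exact Finset.sum_lt_sum (fun i _ => hle i) ⟨j, Finset.mem_univ j, hj⟩
  · push Not at hb
    have : (fun i => min (x i) (Fintype.card ι * (Fintype.card ι * w) ^ Fintype.card ι)) = x :=
      funext fun i => min_eq_left (hb i)
    rwa [this]

lemma mem_nfold_range {d n N : ℕ} (a : Fin n → Fin d → ℤ) (p : Fin d → ℤ) :
    p ∈ nfold d (Set.range a) N ↔ ∃ x : Fin n → ℕ, ∑ i, x i = N ∧ ∑ i, x i • a i = p := by
  classical
  constructor
  · rintro ⟨f, hf, rfl⟩
    choose c hc using hf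
    refine ⟨fun i => (Finset.univ.filter fun j => c j = i).card, ?_, ?_⟩
    · rw [← Finset.card_eq_sum_card_fiberwise (fun _ _ => Finset.mem_coe.2 (Finset.mem_univ _))]
      simp
    · rw [← Finset.sum_fiberwise_of_maps_to (s := Finset.univ) (t := Finset.univ) (g := c)
        fun _ _ => Finset.mem_univ _]
      refine Finset.sum_congr rfl fun i _ => ?_
      rw [Finset.sum_congr rfl (g := fun _ => a i) fun j hj => ?_, Finset.sum_const]
      rw [← hc, (Finset.mem_filter.1 hj).2]
  · rintro ⟨x, rfl, rfl⟩
    refine ⟨fun j => a (finSigmaFinEquiv.symm j).1, fun j => ⟨_, rfl⟩, ?_⟩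
    rw [Equiv.sum_comp finSigmaFinEquiv.symm fun s : (i : Fin n) × Fin (x i) => a s.1,
      Fintype.sum_sigma]
    simp

/-- Sums of `N` generators are counted by the irreducible vectors of weight `N`. -/
lemma ncard_nfold_range {κ : Type*} {d n N : ℕ} (a : Fin n → Fin d → ℤ) (M : Matrix κ (Fin n) ℤ)
    (hM : ∀ g : Fin n → ℤ, M.mulVec g = 0 ↔ ∑ i, g i = 0 ∧ ∑ i, g i • a i = 0)
    [DecidablePred fun x => ¬ Reducible M x] :
    (nfold d (Set.range a) N).ncard =
      (((Finset.univ : Finset (Fin n)).piAntidiag N).filter fun x => ¬ Reducible M x).card := by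
  classical
  have hMxy : ∀ x y : Fin n → ℕ, M.mulVec (fun i => (x i : ℤ) - y i) = 0 ↔
      ∑ i, x i = ∑ i, y i ∧ ∑ i, x i • a i = ∑ i, y i • a i := by
    intro x y
    rw [hM]
    simp only [sub_smul, Finset.sum_sub_distrib, sub_eq_zero, natCast_zsmul]
    norm_cast
  have hpos : ∀ x y : Fin n → ℕ, 0 < toLex (fun i => (x i : ℤ) - y i) ↔
      toLex (fun i => (y i : ℤ)) < toLex fun i => (x i : ℤ) := fun x y =>
    sub_pos (α := Lex (Fin n → ℤ))
  have himage : nfold d (Set.range a) N = (fun x : Fin n → ℕ => ∑ i, x i • a i) ''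
      ((((Finset.univ : Finset (Fin n)).piAntidiag N).filter fun x => ¬ Reducible M x : Finset _) :
        Set (Fin n → ℕ)) := by
    ext p
    rw [mem_nfold_range]
    constructor
    · rintro ⟨x₀, hx₀⟩
      obtain ⟨x, hx, hmin⟩ := Finset.exists_min_image
        (((Finset.univ : Finset (Fin n)).piAntidiag N).filter fun x => ∑ i, x i • a i = p)
        (fun x => toLex fun i => (x i : ℤ)) ⟨x₀, by simpa using hx₀⟩
      simp only [Finset.mem_filter, Finset.mem_piAntidiag, Finset.mem_univ, implies_true,
        and_true] at hx hmin
      refine ⟨x, ?_, hx.2⟩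
      simp only [Finset.coe_filter, Finset.mem_piAntidiag, Finset.mem_univ, implies_true,
        and_true]
      refine ⟨hx.1, ?_⟩
      rintro ⟨y, hy, hyp⟩
      rw [hMxy] at hy
      rw [hpos] at hyp
      exact absurd (hmin y ⟨hy.1 ▸ hx.1, hy.2 ▸ hx.2⟩) (not_le.2 hyp)
    · rintro ⟨x, hx, rfl⟩
      simp only [Finset.coe_filter, Finset.mem_piAntidiag, Finset.mem_univ, implies_true,
        and_true] at hx
      exact ⟨x, hx.1, rfl⟩
  rw [himage, Set.InjOn.ncard_image, Set.ncard_coe_finset]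
  intro x hx y hy hxy
  simp only [Finset.coe_filter, Finset.mem_piAntidiag, Finset.mem_univ, implies_true,
    and_true] at hx hy
  have hs : ∑ i, x i = ∑ i, y i := hx.1.trans hy.1.symm
  rcases lt_trichotomy (toLex fun i => (x i : ℤ)) (toLex fun i => (y i : ℤ)) with h | h | h
  · exact absurd ⟨x, (hMxy y x).2 ⟨hs.symm, hxy.symm⟩, (hpos y x).2 h⟩ hy.2
  · funext i
    exact_mod_cast congrFun (toLex.injective h) i
  · exact absurd ⟨y, (hMxy x y).2 ⟨hs, hxy⟩, (hpos x y).2 h⟩ hx.2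

lemma abs_sub_le_width {d : ℕ} {A : Finset (Fin d → ℤ)} {a b : Fin d → ℤ} (ha : a ∈ A)
    (hb : b ∈ A) (k : Fin d) : |a k - b k| ≤ width d A := by
  have h1 : (a k - b k).natAbs ≤ Finset.univ.sup fun i => (a i - b i).natAbs :=
    Finset.le_sup (f := fun i => (a i - b i).natAbs) (Finset.mem_univ k)
  have h2 : (Finset.univ.sup fun i => (a i - b i).natAbs) ≤ width d A :=
    Finset.le_sup (f := fun p : (Fin d → ℤ) × (Fin d → ℤ) =>
      Finset.univ.sup fun i => (p.1 i - p.2 i).natAbs) (Finset.mk_mem_product ha hb)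
  rw [Int.abs_eq_natAbs]
  exact_mod_cast h1.trans h2

lemma ncard_nfold_le {d : ℕ} {A : Finset (Fin d → ℤ)} {a₀ : Fin d → ℤ} (ha₀ : a₀ ∈ A) (N : ℕ) :
    (nfold d ↑A N).ncard ≤ (2 * width d A * N + 1) ^ d := by
  classical
  have hsub : nfold d ↑A N ⊆ (Finset.Icc (fun k => N * a₀ k - N * width d A)
      (fun k => N * a₀ k + N * width d A) : Finset (Fin d → ℤ)) := by
    rintro p ⟨f, hf, rfl⟩
    have hk : ∀ k, |(∑ j, f j) k - N * a₀ k| ≤ N * width d A := by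
      intro k
      have : (∑ j, f j) k - N * a₀ k = ∑ j, (f j k - a₀ k) := by
        simp [Finset.sum_sub_distrib]
      rw [this]
      refine (Finset.abs_sum_le_sum_abs _ _).trans ?_
      refine (Finset.sum_le_sum fun j _ => abs_sub_le_width (hf j) ha₀ k).trans ?_
      simp
    rw [Finset.coe_Icc, Set.mem_Icc]
    constructor <;> intro k <;> have := abs_le.1 (hk k) <;> simp only <;> linarith
  refine (Set.ncard_le_ncard hsub (Finset.finite_toSet _)).trans ?_
  rw [Set.ncard_coe_finset, Pi.card_Icc]
  refine (Finset.prod_congr rfl fun k _ => ?_).trans_le (by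
    rw [Finset.prod_const, Finset.card_univ, Fintype.card_fin])
  rw [Int.card_Icc]
  have : ((N * a₀ k + N * width d A + 1 - (N * a₀ k - N * width d A) : ℤ)) =
    ((2 * width d A * N + 1 : ℕ) : ℤ) := by push_cast; ring
  rw [this, Int.toNat_natCast]

/-- Effective Khovanskii theorem: `|NA| = P(N)` once `N ≥ (2|A|·w(A))^{(d+4)|A|}`. -/
theorem effective_khovanskii (d : ℕ) (hd : 1 ≤ d)
    (A : Finset (Fin d → ℤ)) (hA : A.Nonempty) :
    ∃ P : Polynomial ℚ, P.natDegree ≤ d ∧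
      ∀ N : ℕ, (2 * A.card * width d A) ^ ((d + 4) * A.card) ≤ N →
        ((nfold d ↑A N).ncard : ℚ) = P.eval (N : ℚ) := by
  classical
  obtain ⟨a₀, ha₀⟩ := hA
  rcases Nat.lt_or_ge 1 A.card with hn | hn
  · have hw : 1 ≤ width d A := by
      obtain ⟨a, ha, b, hb, hab⟩ := Finset.one_lt_card.1 hn
      obtain ⟨k, hk⟩ := Function.ne_iff.1 hab
      have h1 := abs_sub_le_width ha hb k
      have h2 : 0 < |a k - b k| := abs_pos.2 (sub_ne_zero.2 hk)
      omega
    obtain ⟨n, hnA⟩ : ∃ n, n = A.card := ⟨_, rfl⟩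
    let a : Fin n → Fin d → ℤ := fun i => (A.equivFinOfCardEq hnA.symm).symm i
    have haA : ∀ i, a i ∈ A := fun i => ((A.equivFinOfCardEq hnA.symm).symm i).2
    have hrange : (A : Set (Fin d → ℤ)) = Set.range a := by
      ext p
      refine ⟨fun hp => ⟨A.equivFinOfCardEq hnA.symm ⟨p, hp⟩, by simp [a]⟩, ?_⟩
      rintro ⟨i, rfl⟩
      exact haA i
    let M : Matrix (Option (Fin d)) (Fin n) ℤ :=
      Matrix.of fun k i => k.elim 1 fun k => a i k - a₀ k
    have hMw : ∀ k i, |M k i| ≤ width d A := by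
      rintro (_ | k) i
      · simpa [M] using hw
      · simpa [M] using abs_sub_le_width (haA i) ha₀ k
    have hMker : ∀ g : Fin n → ℤ, M.mulVec g = 0 ↔ ∑ i, g i = 0 ∧ ∑ i, g i • a i = 0 := by
      intro g
      have h1 : M.mulVec g none = ∑ i, g i := by simp [M, Matrix.mulVec, dotProduct]
      have h2 : ∀ k, M.mulVec g (some k) = (∑ i, g i • a i) k - (∑ i, g i) * a₀ k := by
        intro k
        simp only [M, Matrix.mulVec, dotProduct, Matrix.of_apply, Option.elim_some,
          Finset.sum_apply, Pi.smul_apply, smul_eq_mul, Finset.sum_mul, ← Finset.sum_sub_distrib]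
        exact Finset.sum_congr rfl fun i _ => by ring
      constructor
      · intro h
        have h3 : ∑ i, g i = 0 := by rw [← h1, h]; rfl
        refine ⟨h3, funext fun k => ?_⟩
        have h4 := h2 k
        rw [h, h3] at h4
        simpa using h4.symm
      · rintro ⟨h3, h4⟩
        funext k
        rcases k with _ | k
        · rw [h1, h3]; rfl
        · rw [h2, h3, h4]; simp
    have hM1 : ∀ g, M.mulVec g = 0 → (∀ i, g i ≤ 0) → g = 0 := by
      intro g hg hg0
      funext i
      exact (Finset.sum_eq_zero_iff_of_nonpos fun i _ => hg0 i).1 ((hMker g).1 hg).1 i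
        (Finset.mem_univ i)
    obtain ⟨P, hP⟩ := exists_poly_card_filter_piAntidiag (n * (n * width d A) ^ n)
      (fun x => ¬ Reducible M x) fun x => not_congr (by
        simpa using reducible_iff_trunc hw hMw hM1 x)
    have hbound : Fintype.card (Fin n) * (n * (n * width d A) ^ n) <
        (2 * A.card * width d A) ^ ((d + 4) * A.card) := by
      rw [Fintype.card_fin, ← hnA]
      rw [← hnA] at hn
      generalize width d A = w at hw
      have h1 : n < 2 * n * w := by nlinarith
      calc n * (n * (n * w) ^ n) = n * n * (n * w) ^ n := by ring
        _ ≤ n * n * (2 * n * w) ^ n := by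
          refine Nat.mul_le_mul_left _ (Nat.pow_le_pow_left ?_ n)
          nlinarith [Nat.zero_le (n * w)]
        _ < (2 * n * w) * (2 * n * w) * (2 * n * w) ^ n :=
          Nat.mul_lt_mul_of_pos_right (Nat.mul_lt_mul'' h1 h1) (by positivity)
        _ = (2 * n * w) ^ (n + 2) := by ring
        _ ≤ (2 * n * w) ^ ((d + 4) * n) := Nat.pow_le_pow_right (by omega) (by nlinarith)
    have hcount : ∀ N : ℕ, (2 * A.card * width d A) ^ ((d + 4) * A.card) ≤ N →
        ((nfold d ↑A N).ncard : ℚ) = P.eval (N : ℚ) := by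
      intro N hN
      rw [← hP N (hbound.trans_le hN), hrange, ncard_nfold_range a M hMker]
    refine ⟨P, natDegree_le_of_eval_le P d (2 * width d A)
      ((2 * A.card * width d A) ^ ((d + 4) * A.card)) fun N hN => ?_, hcount⟩
    rw [← hcount N hN, abs_of_nonneg (by positivity)]
    exact_mod_cast ncard_nfold_le ha₀ N
  · have hA1 : A = {a₀} := (Finset.card_le_one_iff_subset_singleton.1 hn).elim fun b hb => by
      rw [Finset.mem_singleton.1 (hb ha₀)] at *
      exact Finset.Subset.antisymm hb (Finset.singleton_subset_iff.2 ha₀)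
    refine ⟨1, by simp, fun N _ => ?_⟩
    have : nfold d ↑A N = {N • a₀} := by
      ext p
      rw [hA1, Finset.coe_singleton, Set.mem_singleton_iff]
      constructor
      · rintro ⟨f, hf, rfl⟩
        simp [Finset.sum_congr rfl fun j _ => Set.mem_singleton_iff.1 (hf j)]
      · rintro rfl
        exact ⟨fun _ => a₀, fun _ => rfl, by simp⟩
    rw [this]
    simp
end
end

section
/- Let d ≥ 1 and let A ⊂ ℤ^d be a finite set whose convex hull H(A) is a d-simplex. Then there exists a polynomial P ∈ ℚ[X] of degree at most d such that |NA| = P(N) for every integer N ≥ (d+1)!·vol(H(A)) − (d+1)(|A| − d) + 1, where vol denotes d-dimensional Lebesgue volume. -/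
open Pointwise MeasureTheory

noncomputable section

theorem ncard_sum_eq (d n : ℕ) :
    {x : Fin (d + 1) → ℕ | ∑ i, x i = n}.Finite ∧
      {x : Fin (d + 1) → ℕ | ∑ i, x i = n}.ncard = (n + d).choose d := by
  have h : {x : Fin (d + 1) → ℕ | ∑ i, x i = n} =
      ((Finset.univ.piAntidiag n : Finset (Fin (d + 1) → ℕ)) : Set (Fin (d + 1) → ℕ)) := by
    ext x; simp
  rw [h]
  refine ⟨Finset.finite_toSet _, ?_⟩
  rw [Set.ncard_coe_finset, ← Finset.map_sym_eq_piAntidiag, Finset.card_map, Finset.sym_univ,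
    Finset.card_univ, Sym.card_sym_eq_choose, Fintype.card_fin,
    show d + 1 + n - 1 = n + d by omega, Nat.choose_symm_add]

theorem eval_preHilbertPoly_eq_zero {d k n : ℕ} (h₁ : n < k) (h₂ : k ≤ n + d) :
    (Polynomial.preHilbertPoly ℚ d k).eval (n : ℚ) = 0 := by
  obtain ⟨j, rfl⟩ := Nat.exists_eq_add_of_lt h₁
  have : ((n : ℚ) - ((n + j + 1 : ℕ) : ℚ) + 1) = -(j : ℚ) := by push_cast; ring
  simp only [Polynomial.preHilbertPoly, Polynomial.eval_smul, Polynomial.eval_comp,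
    Polynomial.eval_add, Polynomial.eval_sub, Polynomial.eval_X, Polynomial.eval_C,
    Polynomial.eval_one, this]
  rw [ascPochhammer_eval_neg_coe_nat_of_lt (by omega)]
  simp

section Cones

variable {d : ℕ} {L : Type*} [AddCommGroup L]

/-- The translate by `w` of the monoid generated by the family `e`. -/
def orthant (e : Fin (d + 1) → L) (w : L) : Set L :=
  Set.range fun x : Fin (d + 1) → ℕ => w + ∑ i, x i • e i

variable {e : Fin (d + 1) → L} {φ : L →+ (Fin (d + 1) → ℝ)} {h : L →+ ℤ}

theorem coord_sum_zsmul (he : ∀ i, φ (e i) = Pi.single i 1) (x : Fin (d + 1) → ℤ)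
    (j : Fin (d + 1)) : φ (∑ i, x i • e i) j = x j := by
  simp [map_sum, map_zsmul, he, Finset.sum_apply, Pi.single_apply]

theorem coord_sum_nsmul (he : ∀ i, φ (e i) = Pi.single i 1) (x : Fin (d + 1) → ℕ)
    (j : Fin (d + 1)) : φ (∑ i, x i • e i) j = x j := by
  simp [map_sum, map_nsmul, he, Finset.sum_apply, Pi.single_apply]

theorem height_sum_nsmul (he : ∀ i, φ (e i) = Pi.single i 1) (hh : ∀ v, ∑ i, φ v i = h v)
    (x : Fin (d + 1) → ℕ) : h (∑ i, x i • e i) = ∑ i, (x i : ℤ) := by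
  have := hh (∑ i, x i • e i)
  simp only [coord_sum_nsmul he] at this
  exact_mod_cast this.symm

theorem orthant_level (he : ∀ i, φ (e i) = Pi.single i 1) (hh : ∀ v, ∑ i, φ v i = h v)
    {w : L} {k N : ℕ} (hw : h w = k) (hN : k ≤ N + d) :
    {v ∈ orthant e w | h v = N}.Finite ∧
      ({v ∈ orthant e w | h v = N}.ncard : ℚ) =
        (Polynomial.preHilbertPoly ℚ d k).eval (N : ℚ) := by
  have himg : {v ∈ orthant e w | h v = N} =
      (fun x : Fin (d + 1) → ℕ => w + ∑ i, x i • e i) '' {x | k + ∑ i, x i = N} := by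
    ext v
    simp only [orthant, Set.mem_range, Set.mem_image, Set.mem_ofPred_eq]
    constructor
    · rintro ⟨⟨x, rfl⟩, hx⟩
      refine ⟨x, ?_, rfl⟩
      rw [map_add, hw, height_sum_nsmul he hh] at hx
      exact_mod_cast hx
    · rintro ⟨x, hx, rfl⟩
      refine ⟨⟨x, rfl⟩, ?_⟩
      rw [map_add, hw, height_sum_nsmul he hh]
      exact_mod_cast hx
  have hinj : Function.Injective (fun x : Fin (d + 1) → ℕ => w + ∑ i, x i • e i) := by
    intro x y hxy
    funext j
    have := congrArg (fun v => φ v j) (add_left_cancel hxy)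
    simpa [coord_sum_nsmul he] using this
  rw [himg, Set.ncard_image_of_injective _ hinj]
  rcases lt_or_ge N k with hlt | hge
  · have : {x : Fin (d + 1) → ℕ | k + ∑ i, x i = N} = ∅ := by
      ext x; simp; omega
    rw [eval_preHilbertPoly_eq_zero hlt hN, this]
    simp
  · have : {x : Fin (d + 1) → ℕ | k + ∑ i, x i = N} = {x | ∑ i, x i = N - k} := by
      ext x; simp only [Set.mem_ofPred_eq]; omega
    rw [this, (ncard_sum_eq d (N - k)).2, Polynomial.preHilbertPoly_eq_choose_sub_add _ _ hge]
    exact ⟨(ncard_sum_eq d (N - k)).1.image _, rfl⟩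

/-- The nonempty members of this class are the translated orthants whose vertex has
coordinates in `[0, K]`. -/
def IsBoundedOrthant (e : Fin (d + 1) → L) (φ : L →+ (Fin (d + 1) → ℝ)) (K : ℝ) (X : Set L) :
    Prop :=
  X = ∅ ∨ ∃ w, X = orthant e w ∧ ∀ i, 0 ≤ φ w i ∧ φ w i ≤ K

theorem IsBoundedOrthant.inter (he : ∀ i, φ (e i) = Pi.single i 1) {K : ℝ} {X Y : Set L}
    (hX : IsBoundedOrthant e φ K X) (hY : IsBoundedOrthant e φ K Y) :
    IsBoundedOrthant e φ K (X ∩ Y) := by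
  rcases hX with rfl | ⟨w₁, rfl, hw₁⟩
  · simp [IsBoundedOrthant]
  rcases hY with rfl | ⟨w₂, rfl, hw₂⟩
  · simp [IsBoundedOrthant]
  rcases Set.eq_empty_or_nonempty (orthant e w₁ ∩ orthant e w₂) with h0 | ⟨v, ⟨x, hx⟩, ⟨y, hy⟩⟩
  · exact Or.inl h0
  simp only at hx hy
  have key : w₁ + ∑ i, x i • e i = w₂ + ∑ i, y i • e i := hx.trans hy.symm
  have hcoord : ∀ j, φ w₁ j + x j = φ w₂ j + y j := fun j => by
    have := congrArg (fun v => φ v j) key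
    simpa only [map_add, Pi.add_apply, coord_sum_nsmul he] using this
  have split : ∀ {a b c : Fin (d + 1) → ℕ}, (∀ i, a i = b i + c i) →
      ∑ i, a i • e i = ∑ i, b i • e i + ∑ i, c i • e i := fun {a b c} hab => by
    simp only [hab, add_smul, Finset.sum_add_distrib]
  have hsx : ∑ i, x i • e i = ∑ i, (x i - y i) • e i + ∑ i, (min (x i) (y i)) • e i :=
    split fun i => by omega
  have hsy : ∑ i, y i • e i = ∑ i, (y i - x i) • e i + ∑ i, (min (x i) (y i)) • e i :=
    split fun i => by omega
  have hw : w₁ + ∑ i, (x i - y i) • e i = w₂ + ∑ i, (y i - x i) • e i := by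
    rw [hsx, hsy, ← add_assoc, ← add_assoc] at key
    exact add_right_cancel key
  refine Or.inr ⟨w₁ + ∑ i, (x i - y i) • e i, ?_, ?_⟩
  · apply Set.Subset.antisymm
    · rintro _ ⟨⟨x', rfl⟩, ⟨y', hy'⟩⟩
      simp only at hy'
      have hc : ∀ j, φ w₂ j + y' j = φ w₁ j + x' j := fun j => by
        have := congrArg (fun v => φ v j) hy'
        simpa only [map_add, Pi.add_apply, coord_sum_nsmul he] using this
      have hle : ∀ j, x' j + y j = x j + y' j := fun j => by
        have h1 := hc j
        have h2 := hcoord j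
        have : (x' j : ℝ) + y j = x j + y' j := by linarith
        exact_mod_cast this
      refine ⟨fun i => x' i - (x i - y i), ?_⟩
      simp only
      rw [add_assoc, ← split (a := x')]
      intro i
      have := hle i
      omega
    · rintro _ ⟨z, rfl⟩
      refine ⟨⟨fun i => (x i - y i) + z i, ?_⟩, ⟨fun i => (y i - x i) + z i, ?_⟩⟩
      · simp only [add_smul, Finset.sum_add_distrib, add_assoc]
      · simp only [hw]
        simp only [add_smul, Finset.sum_add_distrib, add_assoc]
  · intro i
    rw [map_add, Pi.add_apply, coord_sum_nsmul he]
    rcases le_total (x i) (y i) with hle | hle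
    · simpa [Nat.sub_eq_zero_of_le hle] using hw₁ i
    · rw [Nat.cast_sub hle]
      have := hcoord i
      have := hw₂ i
      constructor <;> linarith

/-- Every level set of `X` is finite, and its size is a polynomial of degree at most `d`
in the level `N` once `N₀ ≤ N + d`. -/
def PolynomialLevels (d : ℕ) (h : L →+ ℤ) (N₀ : ℕ) (X : Set L) : Prop :=
  ∃ P : Polynomial ℚ, P.natDegree ≤ d ∧ ∀ N : ℕ, N₀ ≤ N + d →
    {v ∈ X | h v = N}.Finite ∧ ({v ∈ X | h v = N}.ncard : ℚ) = P.eval (N : ℚ)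

theorem polynomialLevels_empty (N₀ : ℕ) : PolynomialLevels d h N₀ ∅ :=
  ⟨0, by simp, fun N _ => by simp⟩

theorem IsBoundedOrthant.polynomialLevels (he : ∀ i, φ (e i) = Pi.single i 1)
    (hh : ∀ v, ∑ i, φ v i = h v) {K : ℕ} {X : Set L} (hX : IsBoundedOrthant e φ K X) :
    PolynomialLevels d h ((d + 1) * K) X := by
  rcases hX with rfl | ⟨w, rfl, hw⟩
  · exact polynomialLevels_empty _
  have h0 : 0 ≤ h w := by
    have : (0 : ℝ) ≤ h w := hh w ▸ Finset.sum_nonneg fun i _ => (hw i).1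
    exact_mod_cast this
  obtain ⟨k, hk⟩ := Int.eq_ofNat_of_zero_le h0
  have hkK : k ≤ (d + 1) * K := by
    have h1 : (h w : ℝ) ≤ (d + 1) * K := by
      rw [← hh w]
      refine (Finset.sum_le_sum fun i _ => (hw i).2).trans ?_
      simp
    rw [hk] at h1
    exact_mod_cast h1
  exact ⟨_, (Polynomial.natDegree_preHilbertPoly ℚ d k).le, fun N hN =>
    orthant_level he hh hk (hkK.trans hN)⟩

theorem polynomialLevels_biUnion (he : ∀ i, φ (e i) = Pi.single i 1)
    (hh : ∀ v, ∑ i, φ v i = h v) {K : ℕ} {ι : Type*} (s : Finset ι) :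
    ∀ f : ι → Set L, (∀ i ∈ s, IsBoundedOrthant e φ K (f i)) →
      PolynomialLevels d h ((d + 1) * K) (⋃ i ∈ s, f i) := by
  classical
  induction s using Finset.induction_on with
  | empty => intro f _; simpa using polynomialLevels_empty _
  | insert a s _ ih =>
    intro f hf
    have hfa := hf a (Finset.mem_insert_self a s)
    have hfs : ∀ i ∈ s, IsBoundedOrthant e φ K (f i) := fun i hi =>
      hf i (Finset.mem_insert_of_mem hi)
    obtain ⟨P, hP, hP'⟩ := hfa.polynomialLevels he hh
    obtain ⟨Q, hQ, hQ'⟩ := ih f hfs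
    obtain ⟨R, hR, hR'⟩ := ih (fun i => f i ∩ f a) fun i hi => (hfs i hi).inter he hfa
    refine ⟨P + Q - R, ?_, fun N hN => ?_⟩
    · exact (Polynomial.natDegree_sub_le _ _).trans
        (max_le ((Polynomial.natDegree_add_le _ _).trans (max_le hP hQ)) hR)
    obtain ⟨hPf, hPc⟩ := hP' N hN
    obtain ⟨hQf, hQc⟩ := hQ' N hN
    obtain ⟨hRf, hRc⟩ := hR' N hN
    have hU : {v ∈ ⋃ i ∈ insert a s, f i | h v = N} =
        {v ∈ f a | h v = N} ∪ {v ∈ ⋃ i ∈ s, f i | h v = N} := by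
      ext v; simp; tauto
    have hI : {v ∈ ⋃ i ∈ s, f i ∩ f a | h v = N} =
        {v ∈ f a | h v = N} ∩ {v ∈ ⋃ i ∈ s, f i | h v = N} := by
      ext v; simp; tauto
    rw [hU]
    refine ⟨hPf.union hQf, ?_⟩
    have := Set.ncard_union_add_ncard_inter _ _ hPf hQf
    rw [← hI] at this
    rw [Polynomial.eval_sub, Polynomial.eval_add, ← hPc, ← hQc, ← hRc, eq_sub_iff_add_eq]
    exact_mod_cast this


section Reduction

variable {G : Type*} [AddCommGroup G] {κ : L →+ G} {C : Finset L}

theorem exists_nsmul_of_class_eq_zero (he : ∀ i, φ (e i) = Pi.single i 1)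
    (hκ : ∀ v, κ v = 0 → ∃ n : Fin (d + 1) → ℤ, v = ∑ i, n i • e i) {v : L} (hv : κ v = 0)
    (hpos : ∀ i, -1 < φ v i) : ∃ x : Fin (d + 1) → ℕ, v = ∑ i, x i • e i := by
  obtain ⟨n, rfl⟩ := hκ v hv
  refine ⟨fun i => (n i).toNat, Finset.sum_congr rfl fun i _ => ?_⟩
  have h1 := hpos i
  rw [coord_sum_zsmul he] at h1
  have h2 : -1 < n i := by exact_mod_cast h1
  rw [← natCast_zsmul, Int.toNat_of_nonneg (by omega)]

theorem eq_zero_of_class_eq_zero (he : ∀ i, φ (e i) = Pi.single i 1)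
    (hκ : ∀ v, κ v = 0 → ∃ n : Fin (d + 1) → ℤ, v = ∑ i, n i • e i) {v : L} (hv : κ v = 0)
    (hpos : ∀ i, -1 < φ v i) (hlt : ∀ i, φ v i < 1) : v = 0 := by
  obtain ⟨x, rfl⟩ := exists_nsmul_of_class_eq_zero he hκ hv hpos
  refine Finset.sum_eq_zero fun i _ => ?_
  have h1 := hlt i
  rw [coord_sum_nsmul he] at h1
  have h2 : x i < 1 := by exact_mod_cast h1
  rw [Nat.lt_one_iff.mp h2, zero_smul]

theorem coord_list_sum_nonneg {l : List L} (hl : ∀ c ∈ l, ∀ i, 0 ≤ φ c i) (i : Fin (d + 1)) :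
    0 ≤ φ l.sum i := by
  induction l with
  | nil => simp
  | cons a l ih =>
    rw [List.sum_cons, map_add, Pi.add_apply]
    exact add_nonneg (hl a (by simp) i) (ih fun c hc => hl c (List.mem_cons_of_mem _ hc))

theorem exists_shorter_of_split (he : ∀ i, φ (e i) = Pi.single i 1)
    (hκ : ∀ v, κ v = 0 → ∃ n : Fin (d + 1) → ℤ, v = ∑ i, n i • e i)
    (hC : ∀ c ∈ C, ∀ i, 0 ≤ φ c i) {p q r t : List L}
    (hl : ∀ c ∈ p ++ q ++ r, c ∈ C) (ht : ∀ c ∈ t, c ∈ C) (hlen : t.length < q.length)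
    (hcl : κ t.sum = κ q.sum) (hlt : ∀ i, φ t.sum i < 1) :
    ∃ (l' : List L) (x : Fin (d + 1) → ℕ), (∀ c ∈ l', c ∈ C) ∧
      l'.length < (p ++ q ++ r).length ∧ (p ++ q ++ r).sum = l'.sum + ∑ i, x i • e i := by
  obtain ⟨x, hx⟩ := exists_nsmul_of_class_eq_zero (v := q.sum - t.sum) he hκ
    (by rw [map_sub, hcl, sub_self]) fun i => by
      have h1 : 0 ≤ φ q.sum i := coord_list_sum_nonneg
        (fun c hc => hC c (hl c (by simp [hc]))) i
      have h2 := hlt i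
      rw [map_sub, Pi.sub_apply]
      linarith
  refine ⟨p ++ t ++ r, x, ?_, ?_, ?_⟩
  · intro c hc
    simp only [List.mem_append] at hc hl
    rcases hc with (hc | hc) | hc
    · exact hl c (by tauto)
    · exact ht c hc
    · exact hl c (by tauto)
  · simp only [List.length_append]; omega
  · rw [← hx]; simp only [List.sum_append]; abel

theorem exists_shorter [Finite G] (he : ∀ i, φ (e i) = Pi.single i 1)
    (hκ : ∀ v, κ v = 0 → ∃ n : Fin (d + 1) → ℤ, v = ∑ i, n i • e i)
    (hC : ∀ c ∈ C, ∀ i, 0 ≤ φ c i ∧ φ c i < 1) (hC0 : (0 : L) ∉ C) {l : List L}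
    (hl : ∀ c ∈ l, c ∈ C) (hlen : Nat.card G < l.length + C.card) (hl0 : 0 < l.length) :
    ∃ (l' : List L) (x : Fin (d + 1) → ℕ), (∀ c ∈ l', c ∈ C) ∧
      l'.length < l.length ∧ l.sum = l'.sum + ∑ i, x i • e i := by
  classical
  have := Fintype.ofFinite G
  have hC1 : ∀ c ∈ C, ∀ i, 0 ≤ φ c i := fun c hc i => (hC c hc i).1
  have block : ∀ j j', j < j' → j' ≤ l.length → κ (l.take j).sum = κ (l.take j').sum →
      ∃ (l' : List L) (x : Fin (d + 1) → ℕ), (∀ c ∈ l', c ∈ C) ∧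
        l'.length < l.length ∧ l.sum = l'.sum + ∑ i, x i • e i := by
    intro j j' hj hj' hcl
    have hs : l.take j' = l.take j ++ (l.take j').drop j := by
      conv_lhs => rw [← List.take_append_drop j (l.take j')]
      rw [List.take_take, min_eq_left hj.le]
    have hs' : l = l.take j ++ (l.take j').drop j ++ l.drop j' := by
      rw [← hs, List.take_append_drop]
    rw [hs']
    refine exists_shorter_of_split (t := []) he hκ hC1 (by rwa [← hs']) (by simp) ?_ ?_ (by simp)
    · simp; omega
    · rw [hs, List.sum_append, map_add] at hcl
      simpa using (left_eq_add.mp hcl).symm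
  have single : ∀ j, j ≤ l.length → j ≠ 1 → ∀ c ∈ C, κ (l.take j).sum = κ c →
      ∃ (l' : List L) (x : Fin (d + 1) → ℕ), (∀ c ∈ l', c ∈ C) ∧
        l'.length < l.length ∧ l.sum = l'.sum + ∑ i, x i • e i := by
    intro j hj hj1 c hc hcl
    rcases Nat.eq_zero_or_pos j with rfl | hj0
    · have hc0 : c = 0 := eq_zero_of_class_eq_zero he hκ (by simpa using hcl.symm)
        (fun i => by linarith [(hC c hc i).1]) fun i => (hC c hc i).2
      exact absurd (hc0 ▸ hc) hC0
    · have hs : l = [] ++ l.take j ++ l.drop j := by simp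
      rw [hs]
      refine exists_shorter_of_split (t := [c]) he hκ hC1 (by rwa [← hs]) (by simpa using hc)
        ?_ ?_ ?_
      · simp; omega
      · simpa using hcl.symm
      · simpa using fun i => (hC c hc i).2
  let s : Finset (ℕ ⊕ L) := ((Finset.range (l.length + 1)).erase 1).disjSum C
  have hs : (Finset.univ : Finset G).card < s.card := by
    rw [Finset.card_disjSum, Finset.card_erase_of_mem (by simp; omega), Finset.card_range,
      Finset.card_univ, ← Nat.card_eq_fintype_card]
    omega
  obtain ⟨a, ha, b, hb, hab, hf⟩ := Finset.exists_ne_map_eq_of_card_lt_of_maps_to hs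
    (f := Sum.elim (fun j => κ (l.take j).sum) κ) (fun _ _ => Finset.mem_coe.mpr (Finset.mem_univ _))
  rcases a with j | c <;> rcases b with j' | c' <;>
    simp only [s, Finset.inl_mem_disjSum, Finset.inr_mem_disjSum, Finset.mem_erase,
      Finset.mem_range, Nat.lt_succ_iff, ne_eq, Sum.inl.injEq, Sum.inr.injEq, Sum.elim_inl,
      Sum.elim_inr] at ha hb hab hf
  · rcases lt_or_gt_of_ne hab with hlt | hlt
    · exact block j j' hlt hb.2 hf
    · exact block j' j hlt ha.2 hf.symm
  · exact single j ha.2 ha.1 c' hb hf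
  · exact single j' hb.2 hb.1 c ha hf.symm
  · refine absurd (sub_eq_zero.mp (eq_zero_of_class_eq_zero (v := c - c') he hκ ?_ ?_ ?_)) hab
    · rw [map_sub, hf, sub_self]
    · intro i
      rw [map_sub, Pi.sub_apply]
      linarith [(hC c ha i).1, (hC c' hb i).2]
    · intro i
      rw [map_sub, Pi.sub_apply]
      linarith [(hC c ha i).2, (hC c' hb i).1]

theorem exists_short [Finite G] (he : ∀ i, φ (e i) = Pi.single i 1)
    (hκ : ∀ v, κ v = 0 → ∃ n : Fin (d + 1) → ℤ, v = ∑ i, n i • e i)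
    (hC : ∀ c ∈ C, ∀ i, 0 ≤ φ c i ∧ φ c i < 1) (hC0 : (0 : L) ∉ C) {K : ℕ}
    (hK : Nat.card G ≤ K + C.card) :
    ∀ (k : ℕ) (l : List L), l.length = k → (∀ c ∈ l, c ∈ C) →
      ∃ (l' : List L) (x : Fin (d + 1) → ℕ), (∀ c ∈ l', c ∈ C) ∧
        l'.length ≤ K ∧ l.sum = l'.sum + ∑ i, x i • e i := by
  intro k
  induction k using Nat.strong_induction_on with
  | _ k ih =>
    intro l hk hl
    rcases le_or_gt l.length K with hle | hgt
    · exact ⟨l, 0, hl, hle, by simp⟩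
    obtain ⟨l₁, x₁, hl₁, hlt, hs⟩ := exists_shorter he hκ hC hC0 hl (by omega) (by omega)
    obtain ⟨l₂, x₂, hl₂, hle, hs'⟩ := ih l₁.length (hk ▸ hlt) l₁ rfl hl₁
    refine ⟨l₂, x₂ + x₁, hl₂, hle, ?_⟩
    rw [hs, hs', add_assoc]
    simp [add_smul, Finset.sum_add_distrib]

theorem exists_list_of_mem_closure {v : L}
    (hv : v ∈ AddSubmonoid.closure ((C : Set L) ∪ Set.range e)) :
    ∃ (l : List L) (x : Fin (d + 1) → ℕ), (∀ c ∈ l, c ∈ C) ∧ v = l.sum + ∑ i, x i • e i := by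
  induction hv using AddSubmonoid.closure_induction with
  | mem v hv =>
    rcases hv with hv | ⟨i, rfl⟩
    · exact ⟨[v], 0, by simpa using hv, by simp⟩
    · exact ⟨[], Pi.single i 1, by simp, by simp [Pi.single_apply, ite_smul]⟩
  | zero => exact ⟨[], 0, by simp, by simp⟩
  | add v w _ _ hv hw =>
    obtain ⟨l, x, hl, rfl⟩ := hv
    obtain ⟨l', x', hl', rfl⟩ := hw
    refine ⟨l ++ l', x + x', ?_, ?_⟩
    · intro c hc
      rcases List.mem_append.mp hc with hc | hc
      · exact hl c hc
      · exact hl' c hc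
    · simp only [List.sum_append, Pi.add_apply, add_smul, Finset.sum_add_distrib]
      abel

theorem coord_list_sum_le {l : List L} (hl : ∀ c ∈ l, ∀ i, φ c i < 1) (i : Fin (d + 1)) :
    φ l.sum i ≤ l.length := by
  induction l with
  | nil => simp
  | cons a l ih =>
    rw [List.sum_cons, map_add, Pi.add_apply, List.length_cons]
    push_cast
    linarith [hl a (by simp) i, ih fun c hc => hl c (List.mem_cons_of_mem _ hc)]

theorem polynomialLevels_closure [Finite G] (he : ∀ i, φ (e i) = Pi.single i 1)
    (hh : ∀ v, ∑ i, φ v i = h v)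
    (hκ : ∀ v, κ v = 0 → ∃ n : Fin (d + 1) → ℤ, v = ∑ i, n i • e i)
    (hC : ∀ c ∈ C, ∀ i, 0 ≤ φ c i ∧ φ c i < 1) (hC0 : (0 : L) ∉ C) {K : ℕ}
    (hK : Nat.card G ≤ K + C.card) :
    PolynomialLevels d h ((d + 1) * K)
      (AddSubmonoid.closure ((C : Set L) ∪ Set.range e) : Set L) := by
  classical
  have hfin : {l : List C | l.length ≤ K}.Finite := List.finite_length_le C K
  have heq : (AddSubmonoid.closure ((C : Set L) ∪ Set.range e) : Set L) =
      ⋃ l ∈ hfin.toFinset, orthant e (l.map Subtype.val).sum := by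
    ext v
    simp only [SetLike.mem_coe, Set.mem_iUnion, Set.Finite.mem_toFinset, Set.mem_ofPred_eq,
      exists_prop]
    constructor
    · intro hv
      obtain ⟨l, x, hl, rfl⟩ := exists_list_of_mem_closure hv
      obtain ⟨l', x', hl', hle, hs⟩ := exists_short he hκ hC hC0 hK _ l rfl hl
      lift l' to List C using hl'
      refine ⟨l', by simpa using hle, x' + x, ?_⟩
      rw [hs, add_assoc]
      simp [add_smul, Finset.sum_add_distrib]
    · rintro ⟨l, -, x, rfl⟩
      refine add_mem (list_sum_mem ?_) (sum_mem fun i _ => nsmul_mem ?_ _)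
      · intro c hc
        obtain ⟨c, -, rfl⟩ := List.mem_map.mp hc
        exact AddSubmonoid.subset_closure (Or.inl c.2)
      · exact AddSubmonoid.subset_closure (Or.inr ⟨i, rfl⟩)
  rw [heq]
  refine polynomialLevels_biUnion he hh _ _ fun l hl => Or.inr ⟨_, rfl, fun i => ?_⟩
  have hmem : ∀ c ∈ l.map Subtype.val, c ∈ C := fun c hc => by
    obtain ⟨c, -, rfl⟩ := List.mem_map.mp hc
    exact c.2
  refine ⟨coord_list_sum_nonneg (fun c hc i => (hC c (hmem c hc) i).1) i,
    (coord_list_sum_le (fun c hc i => (hC c (hmem c hc) i).2) i).trans ?_⟩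
  simpa using hl

end Reduction

end Cones

theorem volume_corner_ge (d : ℕ) :
    ENNReal.ofReal (1 / d.factorial) ≤
      volume {x : Fin d → ℝ | (∀ i, 0 ≤ x i) ∧ ∑ i, x i ≤ 1} := by
  classical
  set T := {x : Fin d → ℝ | (∀ i, 0 ≤ x i) ∧ ∑ i, x i ≤ 1}
  let ε : Finset (Fin d) → Fin d → ℝ := fun S i => if i ∈ S then -1 else 1
  let f : Finset (Fin d) → (Fin d → ℝ) →ₗ[ℝ] (Fin d → ℝ) := fun S =>
    Matrix.toLin' (Matrix.diagonal (ε S))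
  have hdet : ∀ S, |LinearMap.det (f S)| = 1 := fun S => by
    rw [LinearMap.det_toLin', Matrix.det_diagonal, Finset.abs_prod]
    refine Finset.prod_eq_one fun i _ => ?_
    simp only [ε]
    split_ifs <;> simp
  have hf : ∀ S x i, f S x i = ε S i * x i := fun S x i => by
    simp [f, Matrix.mulVec_diagonal]
  have hvol : ∀ S, volume (f S ⁻¹' T) = volume T := fun S => by
    rw [Measure.addHaar_preimage_linearMap _ (by
      intro h0
      have := hdet S
      simp [h0] at this), abs_inv, hdet S]
    simp
  have hcover : {x : Fin d → ℝ | ∑ i, |x i| ^ (1 : ℝ) < 1} ⊆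
      ⋃ S ∈ (Finset.univ : Finset (Finset (Fin d))), f S ⁻¹' T := by
    intro x hx
    simp only [Real.rpow_one, Set.mem_ofPred_eq] at hx
    simp only [Finset.mem_univ, Set.iUnion_true, Set.mem_iUnion]
    refine ⟨Finset.univ.filter fun i => x i < 0, ?_⟩
    have habs : ∀ i, f (Finset.univ.filter fun i => x i < 0) x i = |x i| := fun i => by
      rw [hf]
      simp only [ε, Finset.mem_filter, Finset.mem_univ, true_and]
      split_ifs with h0
      · rw [abs_of_neg h0]; ring
      · rw [abs_of_nonneg (not_lt.mp h0)]; ring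
    refine ⟨fun i => ?_, ?_⟩
    · rw [habs]; exact abs_nonneg _
    · simp only [habs]; exact hx.le
  have h1 := (measure_mono hcover).trans (measure_biUnion_finset_le (μ := volume) _ _)
  simp only [hvol, Finset.sum_const, Finset.card_univ, Fintype.card_finset, Fintype.card_fin] at h1
  rw [MeasureTheory.volume_sum_rpow_lt_one _ le_rfl] at h1
  have h2 : Real.Gamma (1 / 1 + 1) = 1 := by
    rw [div_one, Real.Gamma_add_one one_ne_zero, Real.Gamma_one, mul_one]
  rw [h2, Fintype.card_fin, div_one, Real.Gamma_nat_eq_factorial, mul_one, nsmul_eq_mul,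
    div_eq_mul_one_div, ENNReal.ofReal_mul (by positivity), ENNReal.ofReal_pow (by norm_num)] at h1
  push_cast at h1
  rw [show ENNReal.ofReal 2 = 2 by simp] at h1
  exact (ENNReal.mul_le_mul_iff_right (by simp) (by simp)).mp h1

theorem emb_add {d : ℕ} (x y : Fin d → ℤ) : emb d (x + y) = emb d x + emb d y := by
  funext i; simp [emb]

theorem emb_sub {d : ℕ} (x y : Fin d → ℤ) : emb d (x - y) = emb d x - emb d y := by
  funext i; simp [emb]

theorem emb_injective (d : ℕ) : Function.Injective (emb d) := fun x y hxy => by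
  funext i
  exact Int.cast_injective (congrFun hxy i)

theorem convexHull_range_eq_image {ι E : Type*} [Fintype ι] [AddCommGroup E] [Module ℝ E]
    (p : ι → E) :
    convexHull ℝ (Set.range p) = (fun w : ι → ℝ => ∑ i, w i • p i) '' stdSimplex ℝ ι := by
  classical
  have h := (Fintype.linearCombination ℝ p).image_convexHull
    (Set.range fun i j : ι => if i = j then (1 : ℝ) else 0)
  rw [convexHull_basis_eq_stdSimplex, ← Set.range_comp] at h
  have h2 : (Fintype.linearCombination ℝ p) ∘ (fun i j : ι => if i = j then (1 : ℝ) else 0) = p := by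
    funext i
    simp [Fintype.linearCombination_apply]
  rw [h2] at h
  rw [← h]
  rfl

section Simplex

variable {d : ℕ} {b : Fin (d + 1) → Fin d → ℤ}

/-- The edge vectors of the simplex with vertices `b` issuing from the vertex `b 0`. -/
def edge (b : Fin (d + 1) → Fin d → ℤ) (i : Fin d) : Fin d → ℤ := b i.succ - b 0

/-- The integer matrix whose rows are the edge vectors. -/
def edgeMatrix (b : Fin (d + 1) → Fin d → ℤ) : Matrix (Fin d) (Fin d) ℤ := Matrix.of (edge b)

theorem abs_det_le_volume_convexHull :
    ENNReal.ofReal (|((edgeMatrix b).det : ℝ)| * (1 / d.factorial)) ≤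
      volume (convexHull ℝ (Set.range fun i => emb d (b i))) := by
  let f : (Fin d → ℝ) →ₗ[ℝ] (Fin d → ℝ) :=
    Matrix.toLin' ((edgeMatrix b).map (Int.cast : ℤ → ℝ)).transpose
  have hdet : LinearMap.det f = ((edgeMatrix b).det : ℝ) := by
    rw [LinearMap.det_toLin', Matrix.det_transpose]
    exact (Int.castRingHom ℝ).map_det (edgeMatrix b) |>.symm
  have hf : ∀ x, f x = ∑ i, x i • (emb d (b i.succ) - emb d (b 0)) := fun x => by
    funext j
    simp [f, Matrix.mulVec, dotProduct, edgeMatrix, edge, emb, mul_comm]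
  set T := {x : Fin d → ℝ | (∀ i, 0 ≤ x i) ∧ ∑ i, x i ≤ 1}
  have hsub : (fun y => emb d (b 0) + y) '' (f '' T) ⊆
      convexHull ℝ (Set.range fun i => emb d (b i)) := by
    rintro _ ⟨_, ⟨x, hx, rfl⟩, rfl⟩
    rw [convexHull_range_eq_image]
    refine ⟨Fin.cons (1 - ∑ i, x i) x, ⟨?_, ?_⟩, ?_⟩
    · intro i
      refine Fin.cases ?_ (fun j => ?_) i
      · simpa using hx.2
      · simpa using hx.1 j
    · simp [Fin.sum_univ_succ]
    · simp only [Fin.sum_univ_succ, Fin.cons_zero, Fin.cons_succ, hf, smul_sub,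
        Finset.sum_sub_distrib, sub_smul, one_smul, Finset.sum_smul]
      abel
  refine le_trans ?_ (measure_mono hsub)
  rw [Set.image_add_left, measure_preimage_add, Measure.addHaar_image_linearMap, hdet,
    ENNReal.ofReal_mul (abs_nonneg _)]
  gcongr
  exact volume_corner_ge d

/-- The edge vectors as a basis of `ℝ^d`. -/
def edgeBasis (hspan : Submodule.span ℝ (Set.range fun i => emb d (edge b i)) = ⊤) :
    Module.Basis (Fin d) ℝ (Fin d → ℝ) :=
  basisOfTopLeSpanOfCardEqFinrank (fun i => emb d (edge b i)) hspan.ge (by simp)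

theorem edgeBasis_apply
    (hspan : Submodule.span ℝ (Set.range fun i => emb d (edge b i)) = ⊤)
    (i : Fin d) : edgeBasis hspan i = emb d (edge b i) := by
  simp [edgeBasis]

theorem det_edgeMatrix_ne_zero
    (hspan : Submodule.span ℝ (Set.range fun i => emb d (edge b i)) = ⊤) :
    (edgeMatrix b).det ≠ 0 := by
  have h := (Module.Basis.isUnit_det (Pi.basisFun ℝ (Fin d)) (edgeBasis hspan)).ne_zero
  intro h0
  apply h
  rw [Pi.basisFun_det_apply]
  have : Matrix.of (edgeBasis hspan) = (edgeMatrix b).map (Int.castRingHom ℝ) := by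
    ext i j
    simp [edgeBasis_apply, edgeMatrix, emb]
  have h2 := (Int.castRingHom ℝ).map_det (edgeMatrix b)
  rw [h0, map_zero] at h2
  rw [this, h2]
  rfl

theorem linearIndependent_edge
    (hspan : Submodule.span ℝ (Set.range fun i => emb d (edge b i)) = ⊤) :
    LinearIndependent ℤ (edge b) :=
  Matrix.linearIndependent_rows_of_det_ne_zero (det_edgeMatrix_ne_zero hspan)

theorem card_quotient_edge
    (hspan : Submodule.span ℝ (Set.range fun i => emb d (edge b i)) = ⊤) :
    Nat.card ((Fin d → ℤ) ⧸ Submodule.span ℤ (Set.range (edge b))) =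
      (edgeMatrix b).det.natAbs := by
  have hli := linearIndependent_edge hspan
  rw [← Submodule.natAbs_det_basis_change (Pi.basisFun ℤ (Fin d)) _ (Module.Basis.span hli),
    Pi.basisFun_det_apply]
  congr 2
  ext i j
  simp [edgeMatrix, Module.Basis.span_apply]

/-- The lifts `(b i, 1)` of the vertices to `ℤ^d × ℤ`. -/
def liftVertex (b : Fin (d + 1) → Fin d → ℤ) (i : Fin (d + 1)) : (Fin d → ℤ) × ℤ := (b i, 1)

/-- The coordinates of `(x, n)` in the basis of lifted vertices. -/
def baryCoord (hspan : Submodule.span ℝ (Set.range fun i => emb d (edge b i)) = ⊤) :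
    (Fin d → ℤ) × ℤ →+ (Fin (d + 1) → ℝ) :=
  AddMonoidHom.mk' (fun v =>
    Fin.cons ((v.2 : ℝ) - ∑ i, (edgeBasis hspan).repr (emb d v.1 - (v.2 : ℝ) • emb d (b 0)) i)
      (fun i => (edgeBasis hspan).repr (emb d v.1 - (v.2 : ℝ) • emb d (b 0)) i)) (by
    intro v w
    have h : emb d (v + w).1 - ((v + w).2 : ℝ) • emb d (b 0) =
        (emb d v.1 - (v.2 : ℝ) • emb d (b 0)) + (emb d w.1 - (w.2 : ℝ) • emb d (b 0)) := by
      rw [Prod.fst_add, Prod.snd_add, emb_add, Int.cast_add, add_smul]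
      abel
    funext i
    refine Fin.cases ?_ (fun j => ?_) i
    · rw [h]
      simp only [map_add, Finsupp.add_apply, Finset.sum_add_distrib, Fin.cons_zero,
        Pi.add_apply, Prod.snd_add, Int.cast_add]
      ring
    · simp only [h, map_add, Finsupp.add_apply, Fin.cons_succ, Pi.add_apply])

theorem sum_baryCoord
    (hspan : Submodule.span ℝ (Set.range fun i => emb d (edge b i)) = ⊤)
    (v : (Fin d → ℤ) × ℤ) :
    ∑ i, baryCoord hspan v i = AddMonoidHom.snd (Fin d → ℤ) ℤ v := by
  simp [baryCoord, Fin.sum_univ_succ]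

theorem baryCoord_of_eq_sum
    (hspan : Submodule.span ℝ (Set.range fun i => emb d (edge b i)) = ⊤)
    {x : Fin d → ℤ} {w : Fin (d + 1) → ℝ} (hw : ∑ i, w i = 1)
    (hx : emb d x = ∑ i, w i • emb d (b i)) : baryCoord hspan (x, 1) = w := by
  have h : emb d x - ((1 : ℤ) : ℝ) • emb d (b 0) =
      ∑ i : Fin d, w i.succ • edgeBasis hspan i := by
    rw [Fin.sum_univ_succ] at hw hx
    simp only [edgeBasis_apply, edge, emb_sub, smul_sub, Finset.sum_sub_distrib, ← Finset.sum_smul]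
    rw [hx, ← sub_eq_iff_eq_add'.mpr hw.symm, Int.cast_one, sub_smul]
    abel
  have hr : ∀ i, (edgeBasis hspan).repr (∑ i : Fin d, w i.succ • edgeBasis hspan i) i = w i.succ :=
    fun i => by rw [Module.Basis.repr_sum_self]
  funext i
  refine Fin.cases ?_ (fun j => ?_) i
  · simp only [baryCoord, AddMonoidHom.mk'_apply, h, hr, Fin.cons_zero]
    rw [Fin.sum_univ_succ] at hw
    push_cast
    linarith
  · simp only [baryCoord, AddMonoidHom.mk'_apply, h, hr, Fin.cons_succ]

theorem baryCoord_liftVertex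
    (hspan : Submodule.span ℝ (Set.range fun i => emb d (edge b i)) = ⊤)
    (i : Fin (d + 1)) :
    baryCoord hspan (liftVertex b i) = Pi.single i 1 :=
  baryCoord_of_eq_sum hspan (by simp) (by simp [Pi.single_apply, ite_smul])

/-- The class of `(x, n)` modulo the lattice generated by the lifted vertices. -/
def latticeClass (b : Fin (d + 1) → Fin d → ℤ) :
    (Fin d → ℤ) × ℤ →+ (Fin d → ℤ) ⧸ Submodule.span ℤ (Set.range (edge b)) :=
  AddMonoidHom.mk' (fun v => Submodule.Quotient.mk (v.1 - v.2 • b 0)) (by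
    intro v w
    rw [← Submodule.Quotient.mk_add, Prod.fst_add, Prod.snd_add, add_smul]
    congr 1
    abel)

theorem eq_sum_of_latticeClass_eq_zero (v : (Fin d → ℤ) × ℤ) (hv : latticeClass b v = 0) :
    ∃ n : Fin (d + 1) → ℤ, v = ∑ i, n i • liftVertex b i := by
  simp only [latticeClass, AddMonoidHom.mk'_apply, Submodule.Quotient.mk_eq_zero] at hv
  obtain ⟨n, hn⟩ := (Submodule.mem_span_range_iff_exists_fun ℤ).mp hv
  refine ⟨Fin.cons (v.2 - ∑ i, n i) n, Prod.ext ?_ ?_⟩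
  · rw [Prod.fst_sum, Fin.sum_univ_succ]
    simp only [Fin.cons_zero, Fin.cons_succ, Prod.smul_fst, liftVertex]
    simp only [edge, smul_sub, Finset.sum_sub_distrib, ← Finset.sum_smul] at hn
    rw [sub_smul, ← sub_add_cancel v.1 (v.2 • b 0), ← hn]
    abel
  · simp [Prod.snd_sum, Fin.sum_univ_succ, liftVertex]

end Simplex

theorem add_mem_nfold {d : ℕ} {A : Set (Fin d → ℤ)} {M N : ℕ} {x y : Fin d → ℤ}
    (hx : x ∈ nfold d A M) (hy : y ∈ nfold d A N) : x + y ∈ nfold d A (M + N) := by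
  obtain ⟨f, hf, rfl⟩ := hx
  obtain ⟨g, hg, rfl⟩ := hy
  refine ⟨Fin.append f g, fun i => ?_, ?_⟩
  · refine Fin.addCases (fun i => ?_) (fun i => ?_) i
    · simpa using hf i
    · simpa using hg i
  · simp [Fin.sum_univ_add]

theorem mem_closure_lift_iff {d : ℕ} {A : Set (Fin d → ℤ)} {N : ℕ} {x : Fin d → ℤ} :
    (x, (N : ℤ)) ∈ AddSubmonoid.closure ((fun a => (a, (1 : ℤ))) '' A) ↔ x ∈ nfold d A N := by
  constructor
  · intro hx
    have key : ∀ v ∈ AddSubmonoid.closure ((fun a => (a, (1 : ℤ))) '' A),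
        ∃ n : ℕ, v.2 = n ∧ v.1 ∈ nfold d A n := by
      intro v hv
      induction hv using AddSubmonoid.closure_induction with
      | mem v hv =>
        obtain ⟨a, ha, rfl⟩ := hv
        exact ⟨1, rfl, fun _ => a, fun _ => ha, by simp⟩
      | zero => exact ⟨0, rfl, Fin.elim0, fun i => i.elim0, by simp⟩
      | add v w _ _ hv hw =>
        obtain ⟨m, hm, hvm⟩ := hv
        obtain ⟨n, hn, hwn⟩ := hw
        exact ⟨m + n, by rw [Prod.snd_add, hm, hn]; push_cast; rfl, add_mem_nfold hvm hwn⟩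
    obtain ⟨n, hn, hx⟩ := key _ hx
    obtain rfl : N = n := Int.ofNat_inj.mp hn
    exact hx
  · rintro ⟨f, hf, rfl⟩
    have : (∑ i, f i, (N : ℤ)) = ∑ i, (f i, (1 : ℤ)) := by
      refine Prod.ext ?_ ?_
      · simp [Prod.fst_sum]
      · simp [Prod.snd_sum]
    rw [this]
    exact sum_mem fun i _ => AddSubmonoid.subset_closure ⟨f i, hf i, rfl⟩

theorem ncard_nfold_eq {d : ℕ} {A : Set (Fin d → ℤ)} (N : ℕ) :
    (nfold d A N).ncard =
      {v ∈ (AddSubmonoid.closure ((fun a => (a, (1 : ℤ))) '' A) : Set ((Fin d → ℤ) × ℤ)) |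
        AddMonoidHom.snd (Fin d → ℤ) ℤ v = N}.ncard := by
  rw [← Set.ncard_image_of_injective (nfold d A N) (f := fun x => (x, (N : ℤ)))
    fun x y hxy => (Prod.ext_iff.mp hxy).1]
  congr 1
  ext ⟨x, n⟩
  simp only [Set.mem_image, Prod.mk.injEq, Set.mem_ofPred_eq, SetLike.mem_coe,
    AddMonoidHom.coe_snd]
  constructor
  · rintro ⟨x, hx, rfl, rfl⟩
    exact ⟨mem_closure_lift_iff.mpr hx, rfl⟩
  · rintro ⟨hx, rfl⟩
    exact ⟨x, mem_closure_lift_iff.mp hx, rfl, rfl⟩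

/-- The vertices of a lattice simplex can be enumerated, with edges spanning `ℝ^d`. -/
theorem IsSimplex.exists_vertices {d : ℕ} {A : Finset (Fin d → ℤ)} (hA : IsSimplex d A) :
    ∃ b : Fin (d + 1) → Fin d → ℤ, Function.Injective b ∧ (∀ i, b i ∈ A) ∧
      Submodule.span ℝ (Set.range fun i => emb d (edge b i)) = ⊤ ∧
      hull d A = convexHull ℝ (Set.range fun i => emb d (b i)) := by
  obtain ⟨B, hBA, hcard, hspan, hhull⟩ := hA
  let σ := (B.equivFinOfCardEq hcard).symm
  have hrange : Set.range (fun i => (σ i : Fin d → ℤ)) = B := by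
    rw [show (fun i => (σ i : Fin d → ℤ)) = Subtype.val ∘ σ from rfl, Set.range_comp,
      σ.surjective.range_eq]
    simp
  refine ⟨fun i => σ i, Subtype.val_injective.comp σ.injective, fun i => hBA (σ i).2, ?_, ?_⟩
  · rw [eq_top_iff, ← hspan, Submodule.span_le, ← hrange]
    have hmem : ∀ i, emb d (σ i) - emb d (σ 0) ∈
        Submodule.span ℝ (Set.range fun i => emb d (edge (fun i => (σ i : Fin d → ℤ)) i)) := by
      intro i
      refine Fin.cases ?_ (fun j => ?_) i
      · simp
      · rw [← emb_sub]
        exact Submodule.subset_span ⟨j, rfl⟩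
    rintro _ ⟨_, ⟨_, ⟨i, rfl⟩, _, ⟨j, rfl⟩, rfl⟩, rfl⟩
    have := Submodule.sub_mem _ (hmem i) (hmem j)
    rw [sub_sub_sub_cancel_right] at this
    simpa only [emb_sub, SetLike.mem_coe] using this
  · rw [← hhull, hull, ← hrange, ← Set.range_comp]
    rfl

/-- Effective Khovanskii theorem, simplex case: `|NA| = P(N)` once
`N ≥ (d+1)!·vol(H(A)) - (d+1)(|A|-d) + 1`. -/
theorem effective_khovanskii_simplex (d : ℕ) (hd : 1 ≤ d)
    (A : Finset (Fin d → ℤ)) (hsimp : IsSimplex d A) :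
    ∃ P : Polynomial ℚ, P.natDegree ≤ d ∧
      ∀ N : ℕ,
        ((d + 1).factorial : ℝ) * (volume (hull d A)).toReal
            - (d + 1) * ((A.card : ℝ) - d) + 1 ≤ (N : ℝ) →
        ((nfold d ↑A N).ncard : ℚ) = P.eval (N : ℚ) := by
  classical
  obtain ⟨b, hb, hbA, hspan, hhull⟩ := hsimp.exists_vertices
  set G := (Fin d → ℤ) ⧸ Submodule.span ℤ (Set.range (edge b))
  have hGcard : Nat.card G = (edgeMatrix b).det.natAbs := card_quotient_edge hspan
  have : Finite G := Nat.finite_of_card_ne_zero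
    (hGcard ▸ Int.natAbs_ne_zero.mpr (det_edgeMatrix_ne_zero hspan))
  let B : Finset (Fin d → ℤ) := Finset.univ.image b
  have hBcard : B.card = d + 1 := by
    rw [Finset.card_image_of_injective _ hb, Finset.card_univ, Fintype.card_fin]
  have hBA : B ⊆ A := Finset.image_subset_iff.mpr fun i _ => hbA i
  let C : Finset ((Fin d → ℤ) × ℤ) := (A \ B).image fun a => (a, 1)
  have hCcard : C.card + (d + 1) = A.card := by
    rw [Finset.card_image_of_injective _ fun x y hxy => (Prod.ext_iff.mp hxy).1, ← hBcard]
    exact Finset.card_sdiff_add_card_eq_card hBA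
  have hgen : (C : Set ((Fin d → ℤ) × ℤ)) ∪ Set.range (liftVertex b) =
      (fun a => (a, (1 : ℤ))) '' (A : Set (Fin d → ℤ)) := by
    have h1 : Set.range (liftVertex b) = (fun a => (a, (1 : ℤ))) '' (B : Set (Fin d → ℤ)) := by
      rw [Finset.coe_image, Finset.coe_univ, Set.image_univ, ← Set.range_comp]
      rfl
    rw [h1, Finset.coe_image, ← Set.image_union, Finset.coe_sdiff,
      Set.sdiff_union_of_subset (Finset.coe_subset.mpr hBA)]
  have hC : ∀ c ∈ C, ∀ i, 0 ≤ baryCoord hspan c i ∧ baryCoord hspan c i < 1 := by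
    intro c hc
    obtain ⟨a, ha, rfl⟩ := Finset.mem_image.mp hc
    obtain ⟨haA, haB⟩ := Finset.mem_sdiff.mp ha
    have hmem : emb d a ∈ hull d A := subset_convexHull ℝ _ ⟨a, haA, rfl⟩
    rw [hhull, convexHull_range_eq_image] at hmem
    obtain ⟨w, ⟨hw0, hw1⟩, hwa⟩ := hmem
    rw [baryCoord_of_eq_sum hspan hw1 hwa.symm]
    refine fun i => ⟨hw0 i, lt_of_not_ge fun hi => haB ?_⟩
    have hle : ∀ j, j ≠ i → w j = 0 := by
      intro j hj
      have h2 := Finset.sum_le_sum_of_subset_of_nonneg (Finset.subset_univ {i, j})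
        (f := w) fun k _ _ => hw0 k
      rw [hw1, Finset.sum_pair hj.symm] at h2
      linarith [hw0 j]
    have hwi : w i = 1 := by
      rw [← hw1, Finset.sum_eq_single i (fun j _ hj => hle j hj) (by simp)]
    refine Finset.mem_image.mpr ⟨i, Finset.mem_univ i, emb_injective d ?_⟩
    rw [← hwa]
    simp only
    rw [Finset.sum_eq_single i (fun j _ hj => by rw [hle j hj, zero_smul]) (by simp), hwi, one_smul]
  have hC0 : (0 : (Fin d → ℤ) × ℤ) ∉ C := by
    simp [C, Prod.ext_iff]
  obtain ⟨P, hP, hPN⟩ := polynomialLevels_closure (K := Nat.card G - C.card)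
    (baryCoord_liftVertex hspan) (sum_baryCoord hspan) eq_sum_of_latticeClass_eq_zero hC hC0
    le_tsub_add
  refine ⟨P, hP, fun N hN => ?_⟩
  rw [ncard_nfold_eq, ← hgen]
  refine (hPN N ?_).2
  rcases le_total (Nat.card G) C.card with hle | hle
  · rw [Nat.sub_eq_zero_of_le hle, mul_zero]
    exact Nat.zero_le _
  have hvol : (Nat.card G : ℝ) ≤ d.factorial * (volume (hull d A)).toReal := by
    have hfin : volume (hull d A) ≠ ⊤ :=
      ((A.finite_toSet.image (emb d)).isCompact_convexHull (𝕜 := ℝ)).measure_lt_top.ne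
    have h1 : ENNReal.ofReal (|((edgeMatrix b).det : ℝ)| * (1 / d.factorial)) ≤
        volume (hull d A) := hhull ▸ abs_det_le_volume_convexHull
    have h2 := (ENNReal.ofReal_le_iff_le_toReal hfin).mp h1
    rw [hGcard, Nat.cast_natAbs, Int.cast_abs]
    rwa [mul_one_div, div_le_iff₀' (by positivity)] at h2
  have hA : (A.card : ℝ) = C.card + (d + 1) := by exact_mod_cast hCcard.symm
  have hfac : ((d + 1).factorial : ℝ) = (d + 1) * d.factorial := by
    rw [Nat.factorial_succ]; push_cast; ring
  have hfinal : ((d : ℝ) + 1) * ((Nat.card G : ℝ) - C.card) ≤ N + d := by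
    have h3 := mul_le_mul_of_nonneg_left hvol (by positivity : (0 : ℝ) ≤ d + 1)
    rw [hA, hfac] at hN
    linarith
  rw [← Nat.cast_sub hle] at hfinal
  exact_mod_cast hfinal
end
end
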